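/- Let N ≥ 3, let p ≥ q > 0 with pq > 1, and let a, b > −2. Assume the quadruple (p,q,a,b) is supercritical and 0 ≤ a − b ≤ (N−2)(p−q). Then the Hénon–Lane–Emden system (HLE) admits no positive solution (u,v) such that ∫_{ℝ^N} u(x)^{N/α̃} dx < ∞ and there exist constants C > 0 and R₀ > 0 with u(x) ≤ C |x|^{−α̃} for all |x| ≥ R₀. -/

import Mathlib

open MeasureTheory Metric Set

noncomputable section

/-- Euclidean space `ℝ^N`. -/
abbrev Euc (N : ℕ) := EuclideanSpace ℝ (Fin N)

/-- The Laplacian of a function `f : ℝ^N → ℝ`, as the sum of the pure second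
partial derivatives. -/
def lap {N : ℕ} (f : Euc N → ℝ) (x : Euc N) : ℝ :=
  ∑ i : Fin N, iteratedFDeriv ℝ 2 f x ![EuclideanSpace.single i 1, EuclideanSpace.single i 1]

/-- `(u, v)` is a solution of the Hénon–Lane–Emden system
`-Δu = |x|^a |v|^{p-1} v`, `-Δv = |x|^b |u|^{q-1} u` on `ℝ^N \ {0}`:
`u, v` are `C²` on `ℝ^N \ {0}`, continuous on `ℝ^N`, and satisfy the equations pointwise. -/
def IsHLESol {N : ℕ} (p q a b : ℝ) (u v : Euc N → ℝ) : Prop :=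
  ContDiffOn ℝ 2 u {x : Euc N | x ≠ 0} ∧ ContDiffOn ℝ 2 v {x : Euc N | x ≠ 0} ∧
  Continuous u ∧ Continuous v ∧
  (∀ x : Euc N, x ≠ 0 → -lap u x = ‖x‖ ^ a * (|v x| ^ (p - 1) * v x)) ∧
  (∀ x : Euc N, x ≠ 0 → -lap v x = ‖x‖ ^ b * (|u x| ^ (q - 1) * u x))

/-- Stability of a (positive) solution of the Hénon–Lane–Emden system on an open set `Ω`:
there exist positive `C²` functions `ξ, ζ` on `Ω` with
`-Δξ ≥ p |x|^a v^{p-1} ζ` and `-Δζ ≥ q |x|^b u^{q-1} ξ` on `Ω`. -/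
def HLEStableOn {N : ℕ} (p q a b : ℝ) (u v : Euc N → ℝ) (Ω : Set (Euc N)) : Prop :=
  ∃ ξ ζ : Euc N → ℝ, ContDiffOn ℝ 2 ξ Ω ∧ ContDiffOn ℝ 2 ζ Ω ∧
    (∀ x ∈ Ω, 0 < ξ x) ∧ (∀ x ∈ Ω, 0 < ζ x) ∧
    (∀ x ∈ Ω, p * ‖x‖ ^ a * v x ^ (p - 1) * ζ x ≤ -lap ξ x) ∧
    (∀ x ∈ Ω, q * ‖x‖ ^ b * u x ^ (q - 1) * ξ x ≤ -lap ζ x)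

/-- Stability outside a compact set `K`: stability on every open set whose closure is
compact and contained in `ℝ^N \ K`. -/
def HLEStableOutside {N : ℕ} (p q a b : ℝ) (u v : Euc N → ℝ) (K : Set (Euc N)) : Prop :=
  IsCompact K ∧
    ∀ Ω : Set (Euc N), IsOpen Ω → IsCompact (closure Ω) → closure Ω ⊆ Kᶜ →
      HLEStableOn p q a b u v Ω

/-- `(u, v)` solves the Lane–Emden system `-Δu = |v|^{p-1} v`, `-Δv = |u|^{q-1} u` on `ℝ^N`. -/
def IsLESol {N : ℕ} (p q : ℝ) (u v : Euc N → ℝ) : Prop :=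
  (∀ x : Euc N, -lap u x = |v x| ^ (p - 1) * v x) ∧
  (∀ x : Euc N, -lap v x = |u x| ^ (q - 1) * u x)

/-- Stability of a (positive) solution of the Lane–Emden system on an open set `Ω`. -/
def LEStableOn {N : ℕ} (p q : ℝ) (u v : Euc N → ℝ) (Ω : Set (Euc N)) : Prop :=
  ∃ ξ ζ : Euc N → ℝ, ContDiffOn ℝ 2 ξ Ω ∧ ContDiffOn ℝ 2 ζ Ω ∧
    (∀ x ∈ Ω, 0 < ξ x) ∧ (∀ x ∈ Ω, 0 < ζ x) ∧
    (∀ x ∈ Ω, p * v x ^ (p - 1) * ζ x ≤ -lap ξ x) ∧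
    (∀ x ∈ Ω, q * u x ^ (q - 1) * ξ x ≤ -lap ζ x)

/-- A function on `ℝ^N` is polynomially bounded. -/
def PolyBounded {N : ℕ} (w : Euc N → ℝ) : Prop :=
  ∃ K L R : ℝ, 0 < K ∧ 0 < L ∧ ∀ x : Euc N, R ≤ ‖x‖ → |w x| ≤ K * ‖x‖ ^ L

/-- The polynomial `G` from Theorem 1.4 (iii). -/
def Gpoly (p q x : ℝ) : ℝ :=
  x ^ 4 - (4 * p * q * (q + 1) / (p + 1)) * x ^ 2 +
    (2 * p * q * (q + 1) * (p + q + 2) / (p + 1) ^ 2) * x -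
    p * q * (q + 1) ^ 2 / (p + 1) ^ 2

open scoped Topology ENNReal

lemma lintegral_euc_smul {N : ℕ} (g : Euc N → ℝ≥0∞) {c : ℝ} (hc : 0 < c) :
    ∫⁻ x, g (c • x) = ENNReal.ofReal (c ^ (-(N : ℝ))) * ∫⁻ x, g x := by
  have h1 : ∫⁻ x, g (c • x) = ∫⁻ y, g y ∂(Measure.map (fun x : Euc N => c • x) volume) :=
    (lintegral_map_equiv g
      ((Homeomorph.smul (isUnit_iff_ne_zero.2 hc.ne').unit).toMeasurableEquiv : Euc N ≃ᵐ Euc N)).symm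
  rw [h1, Measure.map_addHaar_smul volume hc.ne', lintegral_smul_measure, finrank_euclideanSpace,
    Fintype.card_fin, abs_of_pos (by positivity), smul_eq_mul, Real.rpow_neg hc.le,
    Real.rpow_natCast]

lemma lintegral_euc_translate {N : ℕ} (g : Euc N → ℝ≥0∞) (x : Euc N) :
    ∫⁻ y, g (x - y) = ∫⁻ y, g y :=
  lintegral_sub_left_eq_self g x

lemma ae_euc_ne {N : ℕ} (hN : 3 ≤ N) (x : Euc N) : ∀ᵐ y : Euc N, y ≠ x := by
  have : Nonempty (Fin N) := ⟨⟨0, by omega⟩⟩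
  have : volume ({x} : Set (Euc N)) = 0 := measure_singleton x
  exact measure_eq_zero_iff_ae_notMem.1 this

lemma lintegral_scaled_indicator {N : ℕ} (S : ℝ → Set (Euc N)) (hS : ∀ r, MeasurableSet (S r))
    (hscale : ∀ r > 0, ∀ x, x ∈ S r ↔ r⁻¹ • x ∈ S 1) (s : ℝ)
    (hfin : ∫⁻ x in S 1, ENNReal.ofReal (‖x‖ ^ (-s)) < ⊤) :
    ∃ C : ℝ, 0 ≤ C ∧ ∀ r > 0, ∫⁻ x in S r, ENNReal.ofReal (‖x‖ ^ (-s)) ≤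
      ENNReal.ofReal (C * r ^ ((N : ℝ) - s)) := by
  refine ⟨(∫⁻ x in S 1, ENNReal.ofReal (‖x‖ ^ (-s))).toReal, ENNReal.toReal_nonneg, ?_⟩
  intro r hr
  have key : ∀ x : Euc N, (S r).indicator (fun x => ENNReal.ofReal (‖x‖ ^ (-s))) x =
      ENNReal.ofReal (r ^ (-s)) *
        (S 1).indicator (fun x => ENNReal.ofReal (‖x‖ ^ (-s))) (r⁻¹ • x) := by
    intro x
    by_cases hx : x ∈ S r
    · rw [indicator_of_mem hx, indicator_of_mem ((hscale r hr x).1 hx), norm_smul,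
        Real.norm_of_nonneg (by positivity), Real.mul_rpow (by positivity) (norm_nonneg x),
        ← ENNReal.ofReal_mul (by positivity), Real.inv_rpow hr.le]
      have : r ^ (-s) ≠ 0 := by positivity
      congr 1
      field_simp
    · rw [indicator_of_notMem hx, indicator_of_notMem (fun h => hx ((hscale r hr x).2 h)), mul_zero]
  rw [← lintegral_indicator (hS r), lintegral_congr key,
    lintegral_const_mul' _ _ ENNReal.ofReal_ne_top,
    lintegral_euc_smul _ (inv_pos.2 hr), lintegral_indicator (hS 1), ← mul_assoc,
    ← ENNReal.ofReal_mul (by positivity), Real.inv_rpow hr.le, Real.rpow_neg hr.le (N : ℝ), inv_inv,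
    ← Real.rpow_add hr]
  nth_rewrite 1 [← ENNReal.ofReal_toReal hfin.ne]
  rw [← ENNReal.ofReal_mul (by positivity)]
  apply le_of_eq
  congr 1
  rw [mul_comm]
  congr 2
  ring

lemma exists_lintegral_ball_rpow_le {N : ℕ} (hN : 3 ≤ N) {s : ℝ} (hs : s < N) :
    ∃ C : ℝ, 0 ≤ C ∧ ∀ r > 0, ∫⁻ x in ball (0 : Euc N) r, ENNReal.ofReal (‖x‖ ^ (-s)) ≤
      ENNReal.ofReal (C * r ^ ((N : ℝ) - s)) := by
  refine lintegral_scaled_indicator (fun r => ball (0 : Euc N) r) (fun r => measurableSet_ball)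
    (fun r hr x => ?_) s ?_
  · simp only [mem_ball_zero_iff, norm_smul, norm_inv, Real.norm_of_nonneg hr.le]
    rw [inv_mul_lt_iff₀ hr, mul_one]
  · have := integrableOn_ball_of_norm_le_rpow (μ := (volume : Measure (Euc N))) (r := 1)
      (C := 1) (α := s) (f := fun x : Euc N => ‖x‖ ^ (-s)) (by simp; omega) (by simpa using hs)
      (Filter.Eventually.of_forall fun x => by
        rw [one_mul, Real.norm_of_nonneg (by positivity)])
      (by fun_prop : Measurable _).aestronglyMeasurable
    exact Integrable.lintegral_lt_top this

lemma exists_lintegral_compl_ball_rpow_le {N : ℕ} (hN : 3 ≤ N) {s : ℝ} (hs : N < s) :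
    ∃ C : ℝ, 0 ≤ C ∧ ∀ r > 0, ∫⁻ x in (ball (0 : Euc N) r)ᶜ, ENNReal.ofReal (‖x‖ ^ (-s)) ≤
      ENNReal.ofReal (C * r ^ ((N : ℝ) - s)) := by
  refine lintegral_scaled_indicator (fun r => (ball (0 : Euc N) r)ᶜ)
    (fun r => measurableSet_ball.compl) (fun r hr x => ?_) s ?_
  · simp only [mem_compl_iff, mem_ball_zero_iff, norm_smul, norm_inv, Real.norm_of_nonneg hr.le]
    rw [inv_mul_lt_iff₀ hr, mul_one]
  · have h1 := finite_integral_one_add_norm (μ := (volume : Measure (Euc N))) (r := s)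
      (by simpa using hs)
    calc ∫⁻ x in (ball (0 : Euc N) 1)ᶜ, ENNReal.ofReal (‖x‖ ^ (-s))
        ≤ ∫⁻ x in (ball (0 : Euc N) 1)ᶜ,
          ENNReal.ofReal (2 ^ s) * ENNReal.ofReal ((1 + ‖x‖) ^ (-s)) := by
          refine setLIntegral_mono' measurableSet_ball.compl fun x hx => ?_
          have hx1 : 1 ≤ ‖x‖ := by simpa using hx
          rw [← ENNReal.ofReal_mul (by positivity)]
          refine ENNReal.ofReal_le_ofReal ?_
          have hs0 : 0 < s := lt_of_le_of_lt (by positivity) hs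
          rw [Real.rpow_neg (by positivity), Real.rpow_neg (by positivity), ← div_eq_mul_inv,
            ← Real.div_rpow (by positivity) (by positivity), ← Real.inv_rpow (by positivity)]
          refine Real.rpow_le_rpow (by positivity) ?_ hs0.le
          rw [inv_eq_one_div, div_le_div_iff₀ (by positivity) (by positivity)]
          linarith
      _ ≤ ∫⁻ x, ENNReal.ofReal (2 ^ s) * ENNReal.ofReal ((1 + ‖(x : Euc N)‖) ^ (-s)) :=
          setLIntegral_le_lintegral _ _
      _ < ⊤ := by
          rw [lintegral_const_mul' _ _ ENNReal.ofReal_ne_top]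
          exact ENNReal.mul_lt_top ENNReal.ofReal_lt_top h1

lemma exists_lintegral_ball_sub_rpow_le {N : ℕ} (hN : 3 ≤ N) {s : ℝ} (hs : s < N) :
    ∃ C : ℝ, 0 ≤ C ∧ ∀ r > 0, ∀ x : Euc N, ∫⁻ y in ball x r, ENNReal.ofReal (‖x - y‖ ^ (-s)) ≤
      ENNReal.ofReal (C * r ^ ((N : ℝ) - s)) := by
  obtain ⟨C, hC, h⟩ := exists_lintegral_ball_rpow_le hN hs
  refine ⟨C, hC, fun r hr x => le_trans (le_of_eq ?_) (h r hr)⟩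
  rw [← lintegral_indicator measurableSet_ball, ← lintegral_indicator measurableSet_ball,
    ← lintegral_euc_translate (N := N) ((ball (0 : Euc N) r).indicator _) x]
  refine lintegral_congr fun y => ?_
  by_cases hy : y ∈ ball x r
  · rw [indicator_of_mem hy, indicator_of_mem (by rwa [mem_ball_zero_iff, ← dist_eq_norm, dist_comm])]
  · rw [indicator_of_notMem hy, indicator_of_notMem]
    rwa [mem_ball_zero_iff, ← dist_eq_norm, dist_comm]

/-- Upper bound for the Riesz potential of a power weight. -/
lemma exists_riesz_le {N : ℕ} (hN : 3 ≤ N) {σ A : ℝ} (hσ : 0 < σ) (hσA : σ < A) (hA : A < N) :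
    ∃ C : ℝ, 0 ≤ C ∧ ∀ x : Euc N, x ≠ 0 →
      ∫⁻ y : Euc N, ENNReal.ofReal (‖x - y‖ ^ (σ - N) * ‖y‖ ^ (-A)) ≤
        ENNReal.ofReal (C * ‖x‖ ^ (σ - A)) := by
  obtain ⟨C1, hC1, h1⟩ := exists_lintegral_compl_ball_rpow_le hN (s := A + (N - σ)) (by linarith)
  obtain ⟨C2, hC2, h2⟩ := exists_lintegral_ball_rpow_le hN (s := A) hA
  obtain ⟨C3, hC3, h3⟩ := exists_lintegral_ball_sub_rpow_le hN (s := N - σ) (by linarith)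
  have hA0 : 0 < A := hσ.trans hσA
  refine ⟨2 ^ (N - σ) * (C1 * 2 ^ (σ - A)) + 2 ^ (N - σ) * (C2 * 2 ^ (A - N)) +
    2 ^ A * (C3 * 3 ^ σ), by positivity, fun x hx => ?_⟩
  have hr : 0 < ‖x‖ := norm_pos_iff.2 hx
  set r := ‖x‖ with hrdef
  set F : Euc N → ℝ≥0∞ := fun y => ENNReal.ofReal (‖x - y‖ ^ (σ - N) * ‖y‖ ^ (-A)) with hF
  have hcover : (univ : Set (Euc N)) ⊆ ((ball 0 (2 * r))ᶜ ∪ ball 0 (r / 2)) ∪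
      (ball x (3 * r) ∩ (ball 0 (r / 2))ᶜ) := by
    intro y _
    simp only [mem_union, mem_compl_iff, mem_inter_iff, not_lt, mem_ball, dist_zero_right]
    by_cases hy1 : 2 * r ≤ ‖y‖
    · exact Or.inl (Or.inl hy1)
    · by_cases hy2 : ‖y‖ < r / 2
      · exact Or.inl (Or.inr hy2)
      · refine Or.inr ⟨?_, not_lt.1 hy2⟩
        have := dist_le_norm_add_norm y x
        linarith
  have e1 : ∫⁻ y in (ball (0 : Euc N) (2 * r))ᶜ, F y ≤
      ENNReal.ofReal (2 ^ (N - σ) * (C1 * (2 * r) ^ (N - (A + (N - σ))))) := by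
    calc ∫⁻ y in (ball (0 : Euc N) (2 * r))ᶜ, F y
        ≤ ∫⁻ y in (ball (0 : Euc N) (2 * r))ᶜ, ENNReal.ofReal (2 ^ (N - σ)) *
          ENNReal.ofReal (‖y‖ ^ (-(A + (N - σ)))) := by
          refine setLIntegral_mono' measurableSet_ball.compl fun y hy => ?_
          have hy1 : 2 * r ≤ ‖y‖ := by simpa using hy
          have hy0 : 0 < ‖y‖ := by linarith
          rw [← ENNReal.ofReal_mul (by positivity)]
          refine ENNReal.ofReal_le_ofReal ?_
          have h5 : ‖y‖ / 2 ≤ ‖x - y‖ := by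
            have := norm_sub_norm_le y x
            rw [norm_sub_rev] at this
            linarith
          calc ‖x - y‖ ^ (σ - N) * ‖y‖ ^ (-A) ≤ (‖y‖ / 2) ^ (σ - N) * ‖y‖ ^ (-A) := by
                gcongr ?_ * _
                exact Real.rpow_le_rpow_of_nonpos (by positivity) h5 (by linarith)
            _ = 2 ^ (N - σ) * ‖y‖ ^ (-(A + (N - σ))) := by
                rw [Real.div_rpow (by positivity) (by positivity),
                  show -(A + (N - σ)) = (σ - N) + (-A) by ring, Real.rpow_add hy0,
                  show (N - σ) = -(σ - N) by ring, Real.rpow_neg (by norm_num)]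
                field_simp
                rw [← Real.rpow_add (by norm_num), add_neg_cancel, Real.rpow_zero]
      _ ≤ _ := by
          rw [lintegral_const_mul' _ _ ENNReal.ofReal_ne_top, ENNReal.ofReal_mul (by positivity)]
          gcongr
          exact h1 _ (by positivity)
  have e2 : ∫⁻ y in (ball (0 : Euc N) (r / 2)), F y ≤
      ENNReal.ofReal ((r / 2) ^ (σ - N) * (C2 * (r / 2) ^ (N - A))) := by
    calc ∫⁻ y in (ball (0 : Euc N) (r / 2)), F y
        ≤ ∫⁻ y in (ball (0 : Euc N) (r / 2)), ENNReal.ofReal ((r / 2) ^ (σ - N)) *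
          ENNReal.ofReal (‖y‖ ^ (-A)) := by
          refine setLIntegral_mono' measurableSet_ball fun y hy => ?_
          have hy1 : ‖y‖ < r / 2 := by simpa using hy
          rw [← ENNReal.ofReal_mul (by positivity)]
          refine ENNReal.ofReal_le_ofReal ?_
          have h5 : r / 2 ≤ ‖x - y‖ := by
            have := norm_sub_norm_le x y
            linarith
          gcongr ?_ * _
          exact Real.rpow_le_rpow_of_nonpos (by positivity) h5 (by linarith)
      _ ≤ _ := by
          rw [lintegral_const_mul' _ _ ENNReal.ofReal_ne_top, ENNReal.ofReal_mul (by positivity)]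
          gcongr
          exact h2 _ (by positivity)
  have e3 : ∫⁻ y in (ball x (3 * r) ∩ (ball 0 (r / 2))ᶜ), F y ≤
      ENNReal.ofReal ((r / 2) ^ (-A) * (C3 * (3 * r) ^ (N - (N - σ)))) := by
    calc ∫⁻ y in (ball x (3 * r) ∩ (ball 0 (r / 2))ᶜ), F y
        ≤ ∫⁻ y in (ball x (3 * r) ∩ (ball 0 (r / 2))ᶜ), ENNReal.ofReal ((r / 2) ^ (-A)) *
          ENNReal.ofReal (‖x - y‖ ^ (-(N - σ))) := by
          refine setLIntegral_mono' (measurableSet_ball.inter measurableSet_ball.compl)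
            fun y hy => ?_
          have hy1 : r / 2 ≤ ‖y‖ := by simpa using hy.2
          rw [← ENNReal.ofReal_mul (by positivity)]
          refine ENNReal.ofReal_le_ofReal ?_
          rw [mul_comm, neg_sub]
          gcongr ?_ * _
          exact Real.rpow_le_rpow_of_nonpos (by positivity) hy1 (by linarith)
      _ ≤ ∫⁻ y in (ball x (3 * r)), ENNReal.ofReal ((r / 2) ^ (-A)) *
          ENNReal.ofReal (‖x - y‖ ^ (-(N - σ))) := lintegral_mono_set inter_subset_left
      _ ≤ _ := by
          rw [lintegral_const_mul' _ _ ENNReal.ofReal_ne_top, ENNReal.ofReal_mul (by positivity)]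
          gcongr
          exact h3 _ (by positivity) _
  calc ∫⁻ y : Euc N, F y = ∫⁻ y in univ, F y := by rw [setLIntegral_univ]
    _ ≤ ∫⁻ y in (((ball 0 (2 * r))ᶜ ∪ ball 0 (r / 2)) ∪
      (ball x (3 * r) ∩ (ball 0 (r / 2))ᶜ)), F y := lintegral_mono_set hcover
    _ ≤ ((∫⁻ y in (ball (0 : Euc N) (2 * r))ᶜ, F y) + ∫⁻ y in (ball (0 : Euc N) (r / 2)), F y) +
        ∫⁻ y in (ball x (3 * r) ∩ (ball 0 (r / 2))ᶜ), F y :=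
        (lintegral_union_le _ _ _).trans (add_le_add (lintegral_union_le _ _ _) le_rfl)
    _ ≤ (ENNReal.ofReal (2 ^ (N - σ) * (C1 * (2 * r) ^ (N - (A + (N - σ))))) +
        ENNReal.ofReal ((r / 2) ^ (σ - N) * (C2 * (r / 2) ^ (N - A)))) +
        ENNReal.ofReal ((r / 2) ^ (-A) * (C3 * (3 * r) ^ (N - (N - σ)))) :=
        add_le_add (add_le_add e1 e2) e3
    _ = _ := by
        rw [← ENNReal.ofReal_add (by positivity) (by positivity),
          ← ENNReal.ofReal_add (by positivity) (by positivity)]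
        congr 1
        rw [show (N : ℝ) - (A + (N - σ)) = σ - A by ring, show (N : ℝ) - (N - σ) = σ by ring,
          Real.mul_rpow (by norm_num) hr.le, Real.mul_rpow (by norm_num) hr.le,
          Real.div_rpow hr.le (by norm_num), Real.div_rpow hr.le (by norm_num),
          Real.div_rpow hr.le (by norm_num),
          Real.rpow_neg (by norm_num : (0 : ℝ) ≤ 2) A,
          show (σ - N : ℝ) = -(N - σ) by ring, Real.rpow_neg (by norm_num : (0 : ℝ) ≤ 2) (N - σ),
          show (A - N : ℝ) = -(N - A) by ring, Real.rpow_neg (by norm_num : (0 : ℝ) ≤ 2) (N - A)]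
        have t1 : r ^ (σ - A) = r ^ (-(N - σ)) * r ^ (N - A) := by
          rw [← Real.rpow_add hr]; congr 1; ring
        have t2 : r ^ (σ - A) = r ^ (-A) * r ^ σ := by
          rw [← Real.rpow_add hr]; congr 1; ring
        have t3 : (2 : ℝ) ^ (N - σ) * 2 ^ (σ - A) = 2 ^ (N - A) := by
          rw [← Real.rpow_add (by norm_num)]; congr 1; ring
        rw [add_mul, add_mul]
        congr 1
        · congr 1
          · ring
          · rw [t1]; field_simp
        · rw [t2]; field_simp

/-- The partial derivative of `f` in the `i`-th coordinate direction. -/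
def pd {N : ℕ} (i : Fin N) (f : Euc N → ℝ) (x : Euc N) : ℝ :=
  fderiv ℝ f x (EuclideanSpace.single i 1)

lemma lap_eq_sum_pd {N : ℕ} {f : Euc N → ℝ} {x : Euc N} (hf : ContDiffAt ℝ 2 f x) :
    lap f x = ∑ i, pd i (pd i f) x := by
  unfold lap
  refine Finset.sum_congr rfl fun i _ => ?_
  rw [iteratedFDeriv_two_apply]
  have h1 : DifferentiableAt ℝ (fderiv ℝ f) x :=
    (hf.fderiv_right (m := 1) (by norm_num)).differentiableAt (by norm_num)
  unfold pd
  rw [fderiv_clm_apply h1 (differentiableAt_const _)]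
  simp

lemma ContDiff.pd_contDiff {N : ℕ} {f : Euc N → ℝ} {n m : WithTop ℕ∞} (hf : ContDiff ℝ n f)
    (h : m + 1 ≤ n) (i : Fin N) : ContDiff ℝ m (pd i f) :=
  (hf.fderiv_right h).clm_apply contDiff_const

lemma ContDiff.continuous_lap {N : ℕ} {f : Euc N → ℝ} (hf : ContDiff ℝ 2 f) :
    Continuous (lap f) := by
  have : lap f = fun x => ∑ i, pd i (pd i f) x := funext fun x => lap_eq_sum_pd hf.contDiffAt
  rw [this]
  exact continuous_finsetSum _ fun i _ => ((hf.pd_contDiff (m := 1) (by norm_num) i).pd_contDiff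
    (m := 0) (by norm_num) i).continuous

lemma lap_congr_nhds {N : ℕ} {f g : Euc N → ℝ} {x : Euc N} (h : f =ᶠ[𝓝 x] g) :
    lap f x = lap g x := by
  unfold lap
  refine Finset.sum_congr rfl fun i _ => ?_
  rw [iteratedFDeriv_two_apply, iteratedFDeriv_two_apply, h.fderiv.fderiv_eq]

lemma lap_const {N : ℕ} (c : ℝ) (x : Euc N) : lap (fun _ => c) x = 0 := by
  rw [lap_eq_sum_pd contDiffAt_const]
  have h : ∀ i : Fin N, pd i (fun _ : Euc N => c) = fun _ => 0 := fun i => by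
    funext y
    simp [pd]
  simp only [h]
  simp [pd]

lemma pd_comp_affine {N : ℕ} {f : Euc N → ℝ} (hf : Differentiable ℝ f) (c : ℝ) (x y : Euc N)
    (i : Fin N) : pd i (fun y => f (c • (y - x))) y = c * pd i f (c • (y - x)) := by
  unfold pd
  have h1 : HasFDerivAt (fun y : Euc N => c • (y - x)) (c • ContinuousLinearMap.id ℝ (Euc N)) y :=
    ((hasFDerivAt_id y).sub_const x).const_smul c
  have h2 := ((hf (c • (y - x))).hasFDerivAt.comp y h1).fderiv
  have h3 : (fun y => f (c • (y - x))) = f ∘ (fun y : Euc N => c • (y - x)) := rfl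
  rw [h3, h2]
  simp

lemma lap_comp_affine {N : ℕ} {f : Euc N → ℝ} (hf : ContDiff ℝ 2 f) (c : ℝ) (x y : Euc N) :
    lap (fun y => f (c • (y - x))) y = c ^ 2 * lap f (c • (y - x)) := by
  have hg : ContDiff ℝ 2 (fun y : Euc N => f (c • (y - x))) := by fun_prop
  rw [lap_eq_sum_pd hg.contDiffAt, lap_eq_sum_pd hf.contDiffAt, Finset.mul_sum]
  refine Finset.sum_congr rfl fun i _ => ?_
  have h1 : pd i (fun y => f (c • (y - x))) = fun y => c * (fun z => pd i f z) (c • (y - x)) :=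
    funext fun y => pd_comp_affine (hf.differentiable (by norm_num)) c x y i
  have hd : Differentiable ℝ (pd i f) :=
    (hf.pd_contDiff (m := 1) (by norm_num) i).differentiable (by norm_num)
  have hd2 : Differentiable ℝ (fun y : Euc N => pd i f (c • (y - x))) := by fun_prop
  rw [h1]
  have h4 : pd i (fun y => c * pd i f (c • (y - x))) y
      = c * pd i (fun y => pd i f (c • (y - x))) y := by
    unfold pd at hd2 ⊢
    rw [fderiv_const_mul (hd2 y)]
    simp
  rw [h4, pd_comp_affine hd]
  ring

lemma lap_const_mul {N : ℕ} {f : Euc N → ℝ} (hf : ContDiff ℝ 2 f) (c : ℝ) (y : Euc N) :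
    lap (fun y => c * f y) y = c * lap f y := by
  have h1 : ∀ (g : Euc N → ℝ) (i : Fin N), Differentiable ℝ g →
      pd i (fun y => c * g y) = fun y => c * pd i g y := by
    intro g i hg
    funext y
    unfold pd
    rw [fderiv_const_mul (hg y)]
    simp
  rw [lap_eq_sum_pd (by fun_prop), lap_eq_sum_pd hf.contDiffAt, Finset.mul_sum]
  refine Finset.sum_congr rfl fun i _ => ?_
  rw [h1 f i (hf.differentiable (by norm_num)),
    h1 _ i ((hf.pd_contDiff (m := 1) (by norm_num) i).differentiable (by norm_num))]

lemma lap_sub {N : ℕ} {f g : Euc N → ℝ} (hf : ContDiff ℝ 2 f) (hg : ContDiff ℝ 2 g) (y : Euc N) :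
    lap (fun y => f y - g y) y = lap f y - lap g y := by
  have h1 : ∀ (f g : Euc N → ℝ) (i : Fin N), Differentiable ℝ f → Differentiable ℝ g →
      pd i (fun y => f y - g y) = fun y => pd i f y - pd i g y := by
    intro f g i hf hg
    funext y
    unfold pd
    rw [fderiv_fun_sub (hf y) (hg y)]
    simp
  rw [lap_eq_sum_pd (by fun_prop), lap_eq_sum_pd hf.contDiffAt, lap_eq_sum_pd hg.contDiffAt,
    ← Finset.sum_sub_distrib]
  refine Finset.sum_congr rfl fun i _ => ?_
  rw [h1 f g i (hf.differentiable (by norm_num)) (hg.differentiable (by norm_num)),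
    h1 _ _ i ((hf.pd_contDiff (m := 1) (by norm_num) i).differentiable (by norm_num))
    ((hg.pd_contDiff (m := 1) (by norm_num) i).differentiable (by norm_num))]

lemma lap_mul {N : ℕ} {f g : Euc N → ℝ} (hf : ContDiff ℝ 2 f) (hg : ContDiff ℝ 2 g) (y : Euc N) :
    lap (fun y => f y * g y) y =
      f y * lap g y + 2 * ∑ i, pd i f y * pd i g y + g y * lap f y := by
  have h1 : ∀ (f g : Euc N → ℝ) (i : Fin N), Differentiable ℝ f → Differentiable ℝ g →
      pd i (fun y => f y * g y) = fun y => f y * pd i g y + g y * pd i f y := by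
    intro f g i hf hg
    funext y
    unfold pd
    rw [fderiv_fun_mul (hf y) (hg y)]
    simp
  have h2 : ∀ (f g : Euc N → ℝ) (i : Fin N), Differentiable ℝ f → Differentiable ℝ g →
      pd i (fun y => f y + g y) = fun y => pd i f y + pd i g y := by
    intro f g i hf hg
    funext y
    unfold pd
    rw [fderiv_fun_add (hf y) (hg y)]
    simp
  rw [lap_eq_sum_pd (by fun_prop), lap_eq_sum_pd hf.contDiffAt, lap_eq_sum_pd hg.contDiffAt,
    Finset.mul_sum, Finset.mul_sum, Finset.mul_sum, ← Finset.sum_add_distrib,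
    ← Finset.sum_add_distrib]
  refine Finset.sum_congr rfl fun i _ => ?_
  have df := hf.differentiable (by norm_num)
  have dg := hg.differentiable (by norm_num)
  have ddf := (hf.pd_contDiff (m := 1) (by norm_num) i).differentiable (by norm_num)
  have ddg := (hg.pd_contDiff (m := 1) (by norm_num) i).differentiable (by norm_num)
  rw [h1 f g i df dg, h2 _ _ i (by fun_prop) (by fun_prop), h1 _ _ i df ddg, h1 _ _ i dg ddf]
  ring

/-- The fundamental solution is harmonic away from the origin. -/
lemma lap_fundamental {N : ℕ} {z : Euc N} (hz : z ≠ 0) :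
    lap (fun z : Euc N => (‖z‖ ^ 2) ^ (-(((N : ℝ) - 2) / 2))) z = 0 := by
  set s : ℝ := -(((N : ℝ) - 2) / 2) with hs
  have hpos : ∀ z : Euc N, z ≠ 0 → 0 < ‖z‖ ^ 2 := fun z hz => by
    have := norm_pos_iff.2 hz
    positivity
  have hcd : ∀ t : ℝ, ∀ z : Euc N, z ≠ 0 → ContDiffAt ℝ 2 (fun z : Euc N => (‖z‖ ^ 2) ^ t) z :=
    fun t z hz => (contDiff_norm_sq ℝ).contDiffAt.rpow_const_of_ne (hpos z hz).ne'
  have hpd : ∀ t : ℝ, ∀ z : Euc N, z ≠ 0 → ∀ i : Fin N,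
      HasFDerivAt (fun z : Euc N => (‖z‖ ^ 2) ^ t)
        ((t * (‖z‖ ^ 2) ^ (t - 1)) • (2 • (innerSL ℝ z))) z := by
    intro t z hz i
    have h1 : HasFDerivAt (fun z : Euc N => ‖z‖ ^ 2) (2 • (innerSL ℝ z)) z :=
      (hasStrictFDerivAt_norm_sq z).hasFDerivAt
    exact h1.rpow_const (Or.inl (hpos z hz).ne')
  have hpd' : ∀ t : ℝ, ∀ z : Euc N, z ≠ 0 → ∀ i : Fin N,
      pd i (fun z : Euc N => (‖z‖ ^ 2) ^ t) z = 2 * t * ((‖z‖ ^ 2) ^ (t - 1) * z i) := by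
    intro t z hz i
    unfold pd
    rw [(hpd t z hz i).fderiv]
    simp [EuclideanSpace.inner_single_right]
    ring
  rw [lap_eq_sum_pd (hcd s z hz)]
  have hsecond : ∀ i : Fin N, pd i (pd i (fun z : Euc N => (‖z‖ ^ 2) ^ s)) z =
      2 * s * (2 * (s - 1) * ((‖z‖ ^ 2) ^ (s - 2)) * (z i) ^ 2 + (‖z‖ ^ 2) ^ (s - 1)) := by
    intro i
    have hev : pd i (fun z : Euc N => (‖z‖ ^ 2) ^ s) =ᶠ[𝓝 z]
        fun z => 2 * s * ((‖z‖ ^ 2) ^ (s - 1) * z i) := by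
      filter_upwards [isOpen_ne.mem_nhds hz] with y hy using hpd' s y hy i
    have hi : HasFDerivAt (fun z : Euc N => z i) (EuclideanSpace.proj i : Euc N →L[ℝ] ℝ) z :=
      (EuclideanSpace.proj i : Euc N →L[ℝ] ℝ).hasFDerivAt
    have hd : HasFDerivAt (fun z : Euc N => 2 * s * ((‖z‖ ^ 2) ^ (s - 1) * z i)) _ z :=
      ((hpd (s - 1) z hz i).mul hi).const_mul (2 * s)
    have : pd i (pd i (fun z : Euc N => (‖z‖ ^ 2) ^ s)) z
        = fderiv ℝ (fun z : Euc N => 2 * s * ((‖z‖ ^ 2) ^ (s - 1) * z i)) z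
          (EuclideanSpace.single i 1) := by
      conv_lhs => unfold pd
      exact congrArg (fun L : Euc N →L[ℝ] ℝ => L (EuclideanSpace.single i 1)) hev.fderiv_eq
    rw [this, hd.fderiv]
    simp [EuclideanSpace.inner_single_right]
    rw [show s - 1 - 1 = s - 2 by ring]
    ring
  rw [Finset.sum_congr rfl fun i _ => hsecond i, ← Finset.mul_sum, Finset.sum_add_distrib,
    ← Finset.mul_sum]
  have hn : ∑ i, (z i) ^ 2 = ‖z‖ ^ 2 := by
    rw [EuclideanSpace.norm_sq_eq]
    simp
  rw [hn]
  have h3 : (‖z‖ ^ 2) ^ (s - 1) = (‖z‖ ^ 2) ^ (s - 2) * ‖z‖ ^ 2 := by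
    rw [show s - 1 = (s - 2) + 1 by ring, Real.rpow_add (hpos z hz), Real.rpow_one]
  rw [h3]
  simp only [Finset.sum_const, Finset.card_univ, Fintype.card_fin, nsmul_eq_mul]
  rw [hs]
  ring

lemma integrable_norm_rpow_mul {N : ℕ} (hN : 3 ≤ N) {s : ℝ} (hs : -(N : ℝ) < s) {Q : Euc N → ℝ}
    (hQ : Continuous Q) (hc : HasCompactSupport Q) : Integrable (fun y => ‖y‖ ^ s * Q y) := by
  obtain ⟨M, hM⟩ := hQ.bounded_above_of_compact_support hc
  obtain ⟨r, hr⟩ := hc.isCompact.isBounded.subset_ball 0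
  have h := integrableOn_ball_of_norm_le_rpow (μ := (volume : Measure (Euc N))) (r := r)
    (C := M) (α := -s) (f := fun x : Euc N => ‖x‖ ^ s * Q x) (by simp; omega)
    (by simp; linarith)
    (Filter.Eventually.of_forall fun x => by
      rw [norm_mul, Real.norm_of_nonneg (by positivity), neg_neg, mul_comm]
      exact mul_le_mul_of_nonneg_right (hM x) (by positivity))
    (by
      have : Measurable fun x : Euc N => ‖x‖ ^ s * Q x :=
        (measurable_norm.pow_const s).mul hQ.measurable
      exact this.aestronglyMeasurable)
  rwa [integrableOn_iff_integrable_of_support_subset] at h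
  intro y hy
  refine hr (subset_tsupport Q ?_)
  rw [Function.mem_support] at hy ⊢
  exact right_ne_zero_of_mul hy

lemma integrable_mul_of_continuousOn {N : ℕ} {A B φ : Euc N → ℝ}
    (hA : ContinuousOn A {x | x ≠ 0}) (hB : Continuous B) (hBφ : tsupport B ⊆ tsupport φ)
    (hφ : HasCompactSupport φ) (h0 : (0 : Euc N) ∉ tsupport φ) :
    Integrable (fun x => A x * B x) := by
  have hts : tsupport (fun x => A x * B x) ⊆ tsupport B := tsupport_mul_subset_right
  have hcont : Continuous (fun x => A x * B x) := by
    refine continuous_of_tsupport fun x hx => ?_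
    have hx0 : x ≠ 0 := fun h => h0 (h ▸ hBφ (hts hx))
    exact (hA.continuousAt (isOpen_ne.mem_nhds hx0)).mul hB.continuousAt
  exact hcont.integrable_of_hasCompactSupport
    (hφ.mono' ((subset_tsupport _).trans (hts.trans hBφ)))

lemma tsupport_pd_subset {N : ℕ} (i : Fin N) (f : Euc N → ℝ) : tsupport (pd i f) ⊆ tsupport f :=
  tsupport_fderiv_apply_subset ℝ _

lemma integral_mul_pd {N : ℕ} {A B φ : Euc N → ℝ} (i : Fin N)
    (hA : DifferentiableOn ℝ A {x | x ≠ 0}) (hA' : ContinuousOn (pd i A) {x | x ≠ 0})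
    (hB : ContDiff ℝ 1 B) (hBφ : tsupport B ⊆ tsupport φ)
    (hφ : HasCompactSupport φ) (h0 : (0 : Euc N) ∉ tsupport φ) :
    ∫ x, A x * pd i B x = - ∫ x, pd i A x * B x := by
  have hAd : ∀ x ∈ tsupport B, DifferentiableAt ℝ A x := fun x hx =>
    hA.differentiableAt (isOpen_ne.mem_nhds fun h => h0 (h ▸ hBφ hx))
  exact integral_mul_fderiv_eq_neg_fderiv_mul_of_integrable
    (integrable_mul_of_continuousOn hA' hB.continuous hBφ hφ h0)
    (integrable_mul_of_continuousOn hA.continuousOn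
      (hB.pd_contDiff (m := 0) (by norm_num) i).continuous
      ((tsupport_pd_subset i B).trans hBφ) hφ h0)
    (integrable_mul_of_continuousOn hA.continuousOn hB.continuous hBφ hφ h0)
    hAd (fun x _ => hB.differentiable (by norm_num) x)

lemma ContDiffOn.pd_contDiffOn {N : ℕ} {f : Euc N → ℝ} {n m : WithTop ℕ∞} {s : Set (Euc N)}
    (hs : IsOpen s) (hf : ContDiffOn ℝ n f s)
    (h : m + 1 ≤ n) (i : Fin N) : ContDiffOn ℝ m (pd i f) s :=
  (hf.fderiv_of_isOpen hs h).clm_apply contDiffOn_const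

/-- Green's formula for a test function supported away from the origin. -/
lemma integral_mul_lap_of_notMem_tsupport {N : ℕ} {w φ : Euc N → ℝ}
    (hw : ContDiffOn ℝ 2 w {x | x ≠ 0}) (hφ : ContDiff ℝ 2 φ)
    (hc : HasCompactSupport φ) (h0 : (0 : Euc N) ∉ tsupport φ) :
    ∫ x, w x * lap φ x = ∫ x, lap w x * φ x := by
  have hop : IsOpen {x : Euc N | x ≠ 0} := isOpen_ne
  have hpφ : ∀ i, ContDiff ℝ 1 (pd i φ) := fun i => hφ.pd_contDiff (by norm_num) i
  have hpw : ∀ i, ContDiffOn ℝ 1 (pd i w) {x | x ≠ 0} := fun i =>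
    hw.pd_contDiffOn hop (by norm_num) i
  have hppw : ∀ i, ContDiffOn ℝ 0 (pd i (pd i w)) {x | x ≠ 0} := fun i =>
    (hpw i).pd_contDiffOn hop (by norm_num) i
  have h1 : ∀ i, ∫ x, w x * pd i (pd i φ) x = ∫ x, pd i (pd i w) x * φ x := by
    intro i
    rw [integral_mul_pd i (hw.differentiableOn (by norm_num)) (hpw i).continuousOn (hpφ i)
      (tsupport_pd_subset i φ) hc h0, integral_mul_pd i ((hpw i).differentiableOn (by norm_num))
      (hppw i).continuousOn (hφ.of_le (by norm_num)) subset_rfl hc h0, neg_neg]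
  have h2 : ∀ x, w x * lap φ x = ∑ i, w x * pd i (pd i φ) x := fun x => by
    rw [lap_eq_sum_pd hφ.contDiffAt, Finset.mul_sum]
  have h3 : ∀ x, lap w x * φ x = ∑ i, pd i (pd i w) x * φ x := fun x => by
    by_cases hx : x = 0
    · have : φ x = 0 := image_eq_zero_of_notMem_tsupport (hx ▸ h0)
      simp [this]
    · rw [lap_eq_sum_pd (hw.contDiffAt (hop.mem_nhds hx)), Finset.sum_mul]
  simp only [h2, h3]
  rw [integral_finsetSum, integral_finsetSum]
  · exact Finset.sum_congr rfl fun i _ => h1 i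
  · exact fun i _ => integrable_mul_of_continuousOn (hppw i).continuousOn hφ.continuous subset_rfl
      hc h0
  · exact fun i _ => integrable_mul_of_continuousOn hw.continuousOn
      ((hpφ i).pd_contDiff (m := 0) (by norm_num) i).continuous
      ((tsupport_pd_subset i _).trans (tsupport_pd_subset i φ)) hc h0

lemma exists_cutoff (N : ℕ) : ∃ χ : Euc N → ℝ, ContDiff ℝ 2 χ ∧ HasCompactSupport χ ∧
    (∀ y, ‖y‖ ≤ 1 → χ y = 1) ∧ (∀ y, 0 ≤ χ y) ∧ (∀ y, χ y ≤ 1) := by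
  let f : ContDiffBump (0 : Euc N) := ⟨1, 2, by norm_num, by norm_num⟩
  exact ⟨f, f.contDiff, f.hasCompactSupport,
    fun y hy => f.one_of_mem_closedBall (by simpa using hy), fun y => f.nonneg, fun y => f.le_one⟩

lemma hasCompactSupport_lap {N : ℕ} {f : Euc N → ℝ}
    (hc : HasCompactSupport f) : HasCompactSupport (lap f) := by
  refine hc.mono' ?_
  intro x hx
  by_contra h
  refine hx ?_
  have := lap_congr_nhds (notMem_tsupport_iff_eventuallyEq.1 h)
  rw [this]
  exact lap_const 0 x

lemma hasCompactSupport_pd {N : ℕ} {f : Euc N → ℝ} (i : Fin N)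
    (hc : HasCompactSupport f) : HasCompactSupport (pd i f) :=
  hc.mono' ((subset_tsupport _).trans (tsupport_pd_subset i f))

/-- The Laplacian of a product with a concentrated cutoff is controlled by an inverse square. -/
lemma exists_lap_cutoff_mul_bound {N : ℕ} {χ φ : Euc N → ℝ} (hχ : ContDiff ℝ 2 χ)
    (hχc : HasCompactSupport χ) (hφ : ContDiff ℝ 2 φ) (hc : HasCompactSupport φ) :
    ∃ B : Euc N → ℝ, Continuous B ∧ HasCompactSupport B ∧ ∀ c : ℝ, 0 < c → ∀ y ≠ 0,
      |lap (fun y => χ (c • (y - 0)) * φ y) y| ≤ ‖y‖ ^ (-2 : ℝ) * B y := by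
  have hpχ : ∀ i, ContDiff ℝ 1 (pd i χ) := fun i => hχ.pd_contDiff (by norm_num) i
  have hpφ : ∀ i, ContDiff ℝ 1 (pd i φ) := fun i => hφ.pd_contDiff (by norm_num) i
  have e1 : ∀ i, ∃ M, ∀ z : Euc N, ‖‖z‖ * pd i χ z‖ ≤ M := fun i => by
    have := (hpχ i).continuous
    exact (by fun_prop : Continuous fun z : Euc N => ‖z‖ * pd i χ z).bounded_above_of_compact_support
      (hasCompactSupport_pd i hχc).mul_left
  have e1' : ∃ M, ∀ z : Euc N, ‖χ z‖ ≤ M := hχ.continuous.bounded_above_of_compact_support hχc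
  have e2 : ∃ M, ∀ z : Euc N, ‖‖z‖ ^ 2 * lap χ z‖ ≤ M := by
    have := hχ.continuous_lap
    exact (by fun_prop : Continuous fun z : Euc N =>
      ‖z‖ ^ 2 * lap χ z).bounded_above_of_compact_support (hasCompactSupport_lap hχc).mul_left
  obtain ⟨M0, h0⟩ := e1'
  choose M1 h1 using e1
  obtain ⟨M2, h2⟩ := e2
  refine ⟨fun y => ‖y‖ ^ 2 * (M0 * |lap φ y|) + 2 * ∑ i, M1 i * (‖y‖ * |pd i φ y|)
    + M2 * |φ y|, ?_, ?_, ?_⟩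
  · have := hφ.continuous_lap
    have := hφ.continuous
    have := fun i => (hpφ i).continuous
    fun_prop
  · refine HasCompactSupport.add (HasCompactSupport.add ?_ ?_) ?_
    · exact (hasCompactSupport_lap hc).norm.mul_left.mul_left
    · refine HasCompactSupport.mul_left (f := fun _ => (2 : ℝ)) ?_
      refine hc.mono' ?_
      intro y hy
      by_contra hn
      refine hy (Finset.sum_eq_zero fun i _ => ?_)
      rw [image_eq_zero_of_notMem_tsupport (fun h => hn (tsupport_pd_subset i φ h))]
      simp
    · exact hc.norm.mul_left
  · intro c hcpos y hy
    have hχ' : ContDiff ℝ 2 (fun y : Euc N => χ (c • (y - 0))) := by fun_prop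
    rw [lap_mul hχ' hφ, lap_comp_affine hχ]
    have hp : ∀ i, pd i (fun y : Euc N => χ (c • (y - 0))) y = c * pd i χ (c • (y - 0)) :=
      fun i => pd_comp_affine (hχ.differentiable (by norm_num)) c 0 y i
    simp only [hp]
    set z := c • (y - 0) with hz
    have hny : 0 < ‖y‖ := norm_pos_iff.2 hy
    have hnz : ‖z‖ = c * ‖y‖ := by rw [hz, norm_smul, Real.norm_of_nonneg hcpos.le, sub_zero]
    have k0 : |χ z| ≤ M0 := h0 z
    have k1 : ∀ i, ‖y‖ * (c * |pd i χ z|) ≤ M1 i := fun i => by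
      have := h1 i z
      rw [norm_mul, norm_norm, hnz, Real.norm_eq_abs] at this
      linarith
    have k2 : ‖y‖ ^ 2 * (c ^ 2 * |lap χ z|) ≤ M2 := by
      have := h2 z
      rw [norm_mul, norm_pow, norm_norm, hnz, Real.norm_eq_abs] at this
      linarith
    have hrw : ‖y‖ ^ (-2 : ℝ) = (‖y‖ ^ 2)⁻¹ := by
      rw [Real.rpow_neg hny.le]
      norm_num
    rw [hrw, inv_mul_eq_div, le_div_iff₀ (by positivity)]
    calc |χ z * lap φ y + 2 * ∑ i, c * pd i χ z * pd i φ y + φ y * (c ^ 2 * lap χ z)|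
          * ‖y‖ ^ 2
        ≤ (|χ z| * |lap φ y| + 2 * ∑ i, c * |pd i χ z| * |pd i φ y|
          + |φ y| * (c ^ 2 * |lap χ z|)) * ‖y‖ ^ 2 := by
          gcongr
          refine (abs_add_le _ _).trans (add_le_add ((abs_add_le _ _).trans (add_le_add ?_ ?_)) ?_)
          · rw [abs_mul]
          · rw [abs_mul, abs_two]
            gcongr
            refine (Finset.abs_sum_le_sum_abs _ _).trans (le_of_eq ?_)
            refine Finset.sum_congr rfl fun i _ => ?_
            rw [abs_mul, abs_mul, abs_of_pos hcpos]
          · rw [abs_mul, abs_mul, abs_of_nonneg (sq_nonneg c)]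
      _ = ‖y‖ ^ 2 * (|χ z| * |lap φ y|)
          + 2 * ∑ i, (‖y‖ * (c * |pd i χ z|)) * (‖y‖ * |pd i φ y|)
          + (‖y‖ ^ 2 * (c ^ 2 * |lap χ z|)) * |φ y| := by
          have : ∑ i, (‖y‖ * (c * |pd i χ z|)) * (‖y‖ * |pd i φ y|)
              = ‖y‖ ^ 2 * ∑ i, c * |pd i χ z| * |pd i φ y| := by
            rw [Finset.mul_sum]
            exact Finset.sum_congr rfl fun i _ => by ring
          rw [this]
          ring
      _ ≤ _ := by
          gcongr
          exact k1 _

/-- Green's formula across the origin, for a function that is merely continuous there. -/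
lemma integral_mul_lap {N : ℕ} (hN : 3 ≤ N) {w φ : Euc N → ℝ} (hwc : Continuous w)
    (hw : ContDiffOn ℝ 2 w {x | x ≠ 0}) (hφ : ContDiff ℝ 2 φ) (hc : HasCompactSupport φ)
    (hint : Integrable (fun x => lap w x * φ x)) :
    ∫ x, w x * lap φ x = ∫ x, lap w x * φ x := by
  obtain ⟨χ, hχ, hχc, hχ1, hχ0, hχle⟩ := exists_cutoff N
  obtain ⟨B, hB, hBc, hBb⟩ := exists_lap_cutoff_mul_bound hχ hχc hφ hc
  have hχs : ∀ c : ℝ, ContDiff ℝ 2 (fun y : Euc N => χ (c • (y - 0))) := fun c => by fun_prop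
  let P : ℕ → Euc N → ℝ := fun n y => χ (((n : ℝ) + 1) • (y - 0)) * φ y
  have hP : ∀ n, ContDiff ℝ 2 (P n) := fun n => (hχs _).mul hφ
  have hpos : ∀ n : ℕ, (0 : ℝ) < (n : ℝ) + 1 := fun n => by positivity
  have hgreen : ∀ n, ∫ x, w x * (lap φ x - lap (P n) x) = ∫ x, lap w x * (φ x - P n x) := by
    intro n
    have h := integral_mul_lap_of_notMem_tsupport (φ := fun y => φ y - P n y) hw (hφ.sub (hP n))
      (hc.sub hc.mul_left) (by
        rw [notMem_tsupport_iff_eventuallyEq]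
        have : ball (0 : Euc N) (((n : ℝ) + 1)⁻¹) ∈ 𝓝 0 := ball_mem_nhds _ (inv_pos.2 (hpos n))
        filter_upwards [this] with y hy
        have hy1 : ‖((n : ℝ) + 1) • (y - 0)‖ ≤ 1 := by
          rw [norm_smul, sub_zero, Real.norm_of_nonneg (hpos n).le]
          rw [mem_ball_zero_iff] at hy
          calc ((n : ℝ) + 1) * ‖y‖ ≤ ((n : ℝ) + 1) * ((n : ℝ) + 1)⁻¹ := by gcongr
            _ = 1 := mul_inv_cancel₀ (hpos n).ne'
        simp only [P, hχ1 _ hy1, one_mul, sub_self, Pi.zero_apply])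
    rw [← h]
    refine integral_congr_ae (Filter.Eventually.of_forall fun x => ?_)
    simp only [lap_sub hφ (hP n)]
  have hfar : ∀ y : Euc N, y ≠ 0 → ∀ᶠ n : ℕ in Filter.atTop, P n =ᶠ[𝓝 y] fun _ => 0 := by
    intro y hy
    obtain ⟨r, hr⟩ := hχc.isCompact.isBounded.subset_closedBall 0
    have hny : 0 < ‖y‖ := norm_pos_iff.2 hy
    obtain ⟨n₀, hn₀⟩ := exists_nat_gt (r / (‖y‖ / 2))
    filter_upwards [Filter.eventually_ge_atTop n₀] with n hn
    have : {z : Euc N | ‖y‖ / 2 < ‖z‖} ∈ 𝓝 y :=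
      (isOpen_lt continuous_const continuous_norm).mem_nhds (by simpa using hny)
    filter_upwards [this] with z hz
    have : χ (((n : ℝ) + 1) • (z - 0)) = 0 := by
      by_contra hne
      have := hr (subset_tsupport χ hne)
      rw [mem_closedBall_zero_iff, norm_smul, sub_zero, Real.norm_of_nonneg (hpos n).le] at this
      have h2 : (n₀ : ℝ) ≤ n := by exact_mod_cast hn
      rw [div_lt_iff₀ (by positivity)] at hn₀
      have hz' : ‖y‖ / 2 < ‖z‖ := hz
      nlinarith
    simp only [P, this, zero_mul]
  have hae := ae_euc_ne hN 0
  have hL : Filter.Tendsto (fun n => ∫ x, w x * (lap φ x - lap (P n) x)) Filter.atTop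
      (𝓝 (∫ x, w x * lap φ x)) := by
    refine tendsto_integral_of_dominated_convergence
      (fun x => |w x * lap φ x| + ‖x‖ ^ (-2 : ℝ) * (|w x| * B x)) ?_ ?_ ?_ ?_
    · intro n
      exact (hwc.mul (hφ.continuous_lap.sub (hP n).continuous_lap)).aestronglyMeasurable
    · refine Integrable.add ?_ ?_
      · exact ((hwc.mul hφ.continuous_lap).integrable_of_hasCompactSupport
          (hasCompactSupport_lap hc).mul_left).abs
      · have : (3 : ℝ) ≤ N := by exact_mod_cast hN
        exact integrable_norm_rpow_mul hN (by linarith) (hwc.abs.mul hB) hBc.mul_left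
    · intro n
      filter_upwards [hae] with x hx
      rw [mul_sub, Real.norm_eq_abs]
      refine (abs_sub _ _).trans (add_le_add le_rfl ?_)
      rw [abs_mul, mul_left_comm]
      exact mul_le_mul_of_nonneg_left (hBb _ (hpos n) x hx) (abs_nonneg _)
    · filter_upwards [hae] with x hx
      refine tendsto_const_nhds.congr' ?_
      filter_upwards [hfar x hx] with n hn
      rw [lap_congr_nhds hn, lap_const, sub_zero]
  have hR : Filter.Tendsto (fun n => ∫ x, lap w x * (φ x - P n x)) Filter.atTop
      (𝓝 (∫ x, lap w x * φ x)) := by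
    have hrw : ∀ n x, lap w x * (φ x - P n x)
        = (1 - χ (((n : ℝ) + 1) • (x - 0))) * (lap w x * φ x) := fun n x => by
      simp only [P]
      ring
    refine tendsto_integral_of_dominated_convergence (fun x => |lap w x * φ x|) ?_ hint.abs ?_ ?_
    · intro n
      simp only [hrw]
      exact ((continuous_const.sub (hχs _).continuous).aestronglyMeasurable).mul
        hint.aestronglyMeasurable
    · intro n
      refine Filter.Eventually.of_forall fun x => ?_
      rw [hrw, norm_mul, Real.norm_eq_abs, Real.norm_eq_abs]
      refine mul_le_of_le_one_left (abs_nonneg _) ?_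
      rw [abs_le]
      constructor <;> linarith [hχ0 (((n : ℝ) + 1) • (x - 0)), hχle (((n : ℝ) + 1) • (x - 0))]
    · filter_upwards [hae] with x hx
      refine tendsto_const_nhds.congr' ?_
      filter_upwards [hfar x hx] with n hn
      rw [hn.eq_of_nhds, sub_zero]
  exact tendsto_nhds_unique hL (by simpa only [hgreen] using hR)

/-- A truncation of the fundamental solution near the origin. -/
structure IsProfile {N : ℕ} (Φ : Euc N → ℝ) : Prop where
  contDiff : ContDiff ℝ 2 Φ
  lap_support : HasCompactSupport (lap Φ)
  lap_zero : ∀ z, ‖z‖ < 1 / 2 → lap Φ z = 0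
  eq_far : ∀ c : ℝ, 0 < c → ∀ z, 1 ≤ c * ‖z‖ → c ^ ((N : ℝ) - 2) * Φ (c • z) = ‖z‖ ^ (2 - (N : ℝ))
  eq_zero : ∀ z, ‖z‖ ≤ 1 / 2 → Φ z = 0
  mono : ∀ c d : ℝ, 0 < c → c ≤ d → ∀ z,
    c ^ ((N : ℝ) - 2) * Φ (c • z) ≤ d ^ ((N : ℝ) - 2) * Φ (d • z)

lemma exists_profile (N : ℕ) : ∃ Φ : Euc N → ℝ, IsProfile Φ := by
  set s : ℝ := -(((N : ℝ) - 2) / 2) with hs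
  let χ : ℝ → ℝ := fun t => Real.smoothTransition ((4 * t - 1) / 3)
  have hχ : ContDiff ℝ 2 χ := Real.smoothTransition.contDiff.comp (by fun_prop)
  have hχ0 : ∀ t, t ≤ 1 / 4 → χ t = 0 := fun t ht =>
    Real.smoothTransition.zero_of_nonpos (by linarith)
  have hχ1 : ∀ t, 1 ≤ t → χ t = 1 := fun t ht =>
    Real.smoothTransition.one_of_one_le (by linarith)
  have hχm : Monotone χ := fun t t' h => Real.smoothTransition.monotone (by linarith)
  let Φ : Euc N → ℝ := fun z => χ (‖z‖ ^ 2) * (‖z‖ ^ 2) ^ s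
  have hz0 : ∀ z, ‖z‖ ≤ 1 / 2 → Φ z = 0 := fun z hz => by
    have : ‖z‖ ^ 2 ≤ 1 / 4 := by nlinarith [norm_nonneg z]
    simp only [Φ, hχ0 _ this, zero_mul]
  have hnear : ∀ z : Euc N, ‖z‖ < 1 / 2 → Φ =ᶠ[𝓝 z] fun _ => 0 := fun z hz => by
    filter_upwards [(isOpen_lt continuous_norm continuous_const).mem_nhds hz] with y hy
    exact hz0 y (le_of_lt hy)
  have hscale : ∀ c : ℝ, 0 < c → ∀ z : Euc N,
      c ^ ((N : ℝ) - 2) * Φ (c • z) = χ (c ^ 2 * ‖z‖ ^ 2) * (‖z‖ ^ 2) ^ s := by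
    intro c hc z
    simp only [Φ]
    rw [norm_smul, Real.norm_of_nonneg hc.le, mul_pow, Real.mul_rpow (by positivity) (by positivity),
      ← Real.rpow_natCast c 2, ← Real.rpow_mul hc.le]
    have : c ^ ((N : ℝ) - 2) * c ^ (((2 : ℕ) : ℝ) * s) = 1 := by
      rw [← Real.rpow_add hc, hs]
      simp
      ring_nf
      simp
    linear_combination χ (c ^ (((2 : ℕ) : ℝ)) * ‖z‖ ^ 2) * (‖z‖ ^ 2) ^ s * this
  refine ⟨Φ, ?_, ?_, ?_, ?_, hz0, ?_⟩
  · rw [contDiff_iff_contDiffAt]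
    intro z
    by_cases hz : ‖z‖ < 1 / 2
    · exact contDiffAt_const.congr_of_eventuallyEq (hnear z hz)
    · have hpos : 0 < ‖z‖ ^ 2 := by
        have : 0 < ‖z‖ := by linarith
        positivity
      exact (hχ.comp (contDiff_norm_sq ℝ)).contDiffAt.mul
        ((contDiff_norm_sq ℝ).contDiffAt.rpow_const_of_ne hpos.ne')
  · refine HasCompactSupport.intro (isCompact_closedBall (0 : Euc N) 1) fun z hz => ?_
    rw [mem_closedBall_zero_iff, not_le] at hz
    have : Φ =ᶠ[𝓝 z] fun z => (‖z‖ ^ 2) ^ s := by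
      filter_upwards [(isOpen_lt continuous_const continuous_norm).mem_nhds hz] with y hy
      have hy' : 1 < ‖y‖ := hy
      have : 1 ≤ ‖y‖ ^ 2 := by nlinarith
      simp only [Φ, hχ1 _ this, one_mul]
    rw [lap_congr_nhds this]
    exact lap_fundamental (norm_pos_iff.1 (by linarith))
  · intro z hz
    rw [lap_congr_nhds (hnear z hz), lap_const]
  · intro c hc z hz
    rw [hscale c hc z, hχ1 _ (by rw [← mul_pow]; nlinarith), one_mul, ← Real.rpow_natCast ‖z‖ 2,
      ← Real.rpow_mul (norm_nonneg z), hs]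
    congr 1
    push_cast
    ring
  · intro c d hc hcd z
    rw [hscale c hc z, hscale d (hc.trans_le hcd) z]
    gcongr
    exact hχm (by gcongr)

lemma IsProfile.integral_scaled {N : ℕ} {Φ : Euc N → ℝ} (hΦ : IsProfile Φ) (w : Euc N → ℝ)
    (x : Euc N) {c : ℝ} (hc : 0 < c) :
    ∫ y, w y * lap (fun y => c ^ ((N : ℝ) - 2) * Φ (c • (y - x))) y
      = ∫ z, w (x + c⁻¹ • z) * lap Φ z := by
  have h1 : ∀ y, w y * lap (fun y => c ^ ((N : ℝ) - 2) * Φ (c • (y - x))) y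
      = c ^ N * (fun z => w (x + c⁻¹ • z) * lap Φ z) (c • (y - x)) := by
    intro y
    have hs : ContDiff ℝ 2 (fun y => Φ (c • (y - x))) := by
      have := hΦ.contDiff
      fun_prop
    rw [lap_const_mul hs, lap_comp_affine hΦ.contDiff]
    have h2 : c ^ ((N : ℝ) - 2) * c ^ 2 = c ^ N := by
      rw [← Real.rpow_natCast c 2, ← Real.rpow_add hc, ← Real.rpow_natCast c N]
      congr 1
      push_cast
      ring
    have h3 : x + c⁻¹ • c • (y - x) = y := by
      rw [inv_smul_smul₀ hc.ne']
      abel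
    simp only [h3]
    rw [← h2]
    ring
  simp only [h1]
  rw [integral_const_mul, integral_sub_right_eq_self (fun y => (fun z => w (x + c⁻¹ • z) * lap Φ z)
    (c • y)) x, Measure.integral_comp_smul volume (fun z => w (x + c⁻¹ • z) * lap Φ z) c, finrank_euclideanSpace, Fintype.card_fin,
    abs_of_pos (by positivity), smul_eq_mul, ← mul_assoc, mul_inv_cancel₀ (by positivity), one_mul]

/-- Representation of a superharmonic function by the Newtonian potential of its Laplacian. -/
lemma IsProfile.representation {N : ℕ} (hN : 3 ≤ N) {Φ : Euc N → ℝ} (hΦ : IsProfile Φ)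
    {w h : Euc N → ℝ} (hwc : Continuous w)
    (hw : ContDiffOn ℝ 2 w {x | x ≠ 0}) (hh : ∀ x, x ≠ 0 → -lap w x = h x) (hh0 : ∀ x, 0 ≤ h x)
    (hhm : Measurable h)
    (hloc : ∀ Q : Euc N → ℝ, Continuous Q → HasCompactSupport Q → Integrable fun y => h y * Q y)
    (x : Euc N) (hM : Filter.Tendsto (fun n : ℕ => ∫ z, w (x + ((n : ℝ) + 1) • z) * lap Φ z)
      Filter.atTop (𝓝 0)) :
    ENNReal.ofReal (-(∫ z, lap Φ z) * w x) =
      ∫⁻ y, ENNReal.ofReal (‖x - y‖ ^ (2 - (N : ℝ)) * h y) := by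
  let T : ℝ → Euc N → ℝ := fun c y => c ^ ((N : ℝ) - 2) * Φ (c • (y - x))
  have hT : ∀ c, ContDiff ℝ 2 (T c) := fun c => by
    have := hΦ.contDiff
    fun_prop
  have hpos : ∀ n : ℕ, (0 : ℝ) < (n : ℝ) + 1 := fun n => by positivity
  let P : ℕ → Euc N → ℝ := fun n y => T ((n : ℝ) + 1) y - T (((n : ℝ) + 1)⁻¹) y
  have hP : ∀ n, ContDiff ℝ 2 (P n) := fun n => (hT _).sub (hT _)
  have hinv : ∀ n : ℕ, ((n : ℝ) + 1)⁻¹ ≤ (n : ℝ) + 1 := fun n => by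
    have : (1 : ℝ) ≤ (n : ℝ) + 1 := by
      have : (0 : ℝ) ≤ n := by positivity
      linarith
    exact (inv_le_one_of_one_le₀ this).trans this
  have hP0 : ∀ n y, 0 ≤ P n y := fun n y =>
    sub_nonneg.2 (hΦ.mono _ _ (inv_pos.2 (hpos n)) (hinv n) (y - x))
  have hPm : ∀ y, Monotone fun n => P n y := fun y n m hnm => by
    have h1 : (n : ℝ) + 1 ≤ (m : ℝ) + 1 := by
      have : (n : ℝ) ≤ m := by exact_mod_cast hnm
      linarith
    exact sub_le_sub (hΦ.mono _ _ (hpos n) h1 (y - x))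
      (hΦ.mono _ _ (inv_pos.2 (hpos m)) (inv_anti₀ (hpos n) h1) (y - x))
  have hPc : ∀ n, HasCompactSupport (P n) := fun n => by
    refine HasCompactSupport.intro (isCompact_closedBall x ((n : ℝ) + 1)) fun y hy => ?_
    rw [mem_closedBall, dist_eq_norm, not_le] at hy
    have h1 : 1 ≤ ((n : ℝ) + 1)⁻¹ * ‖y - x‖ := by
      rw [inv_mul_eq_div, one_le_div (hpos n)]
      exact hy.le
    have h2 : 1 ≤ ((n : ℝ) + 1) * ‖y - x‖ :=
      h1.trans (mul_le_mul_of_nonneg_right (hinv n) (norm_nonneg _))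
    simp only [P, T]
    rw [hΦ.eq_far _ (hpos n) _ h2, hΦ.eq_far _ (inv_pos.2 (hpos n)) _ h1, sub_self]
  have hPlim : ∀ y, y ≠ x → Filter.Tendsto (fun n => P n y) Filter.atTop
      (𝓝 (‖x - y‖ ^ (2 - (N : ℝ)))) := by
    intro y hy
    have hny : 0 < ‖y - x‖ := norm_pos_iff.2 (sub_ne_zero.2 hy)
    refine tendsto_const_nhds.congr' ?_
    obtain ⟨n1, hn1⟩ := exists_nat_gt (2 * ‖y - x‖)
    obtain ⟨n2, hn2⟩ := exists_nat_gt (‖y - x‖⁻¹)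
    filter_upwards [Filter.eventually_ge_atTop n1, Filter.eventually_ge_atTop n2] with n h1 h2
    have h1' : (n1 : ℝ) ≤ n := by exact_mod_cast h1
    have h2' : (n2 : ℝ) ≤ n := by exact_mod_cast h2
    have e1 : 1 ≤ ((n : ℝ) + 1) * ‖y - x‖ := by
      rw [← div_le_iff₀ hny, one_div]
      linarith
    have e2 : ‖((n : ℝ) + 1)⁻¹ • (y - x)‖ ≤ 1 / 2 := by
      rw [norm_smul, Real.norm_of_nonneg (inv_pos.2 (hpos n)).le, inv_mul_eq_div,
        div_le_iff₀ (hpos n)]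
      linarith
    simp only [P, T]
    rw [hΦ.eq_far _ (hpos n) _ e1, hΦ.eq_zero _ e2, mul_zero, sub_zero, norm_sub_rev]
  have hae := ae_euc_ne hN 0
  have hPint : ∀ n, Integrable fun y => h y * P n y := fun n =>
    hloc _ (hP n).continuous (hPc n)
  have hgreen : ∀ n : ℕ, ∫ y, h y * P n y = -(∫ z, w (x + ((n : ℝ) + 1)⁻¹ • z) * lap Φ z)
      + ∫ z, w (x + ((n : ℝ) + 1) • z) * lap Φ z := by
    intro n
    have hcongr : (fun y => lap w y * P n y) =ᵐ[volume] fun y => -(h y * P n y) := by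
      filter_upwards [hae] with y hy
      rw [← hh y hy]
      ring
    have h1 := integral_mul_lap hN hwc hw (hP n) (hPc n) ((hPint n).neg.congr hcongr.symm)
    rw [integral_congr_ae hcongr, integral_neg] at h1
    have hTi : ∀ c : ℝ, 0 < c → Integrable fun y => w y * lap (T c) y := fun c hc => by
      refine (hwc.mul (hT c).continuous_lap).integrable_of_hasCompactSupport
        (HasCompactSupport.mul_left ?_)
      have h2 : lap (T c) = fun y => (c ^ ((N : ℝ) - 2) * c ^ 2) * lap Φ (c • (y - x)) := by
        funext y
        have hs : ContDiff ℝ 2 (fun y => Φ (c • (y - x))) := by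
          have := hΦ.contDiff
          fun_prop
        simp only [T]
        rw [lap_const_mul hs, lap_comp_affine hΦ.contDiff]
        ring
      rw [h2]
      refine HasCompactSupport.mul_left ?_
      exact hΦ.lap_support.comp_homeomorph ((Homeomorph.subRight x).trans
        (Homeomorph.smul (isUnit_iff_ne_zero.2 hc.ne').unit))
    have h3 : ∀ y, w y * lap (P n) y
        = w y * lap (T ((n : ℝ) + 1)) y - w y * lap (T (((n : ℝ) + 1)⁻¹)) y := fun y => by
      rw [← mul_sub, ← lap_sub (hT _) (hT _)]
    simp only [h3] at h1
    rw [integral_sub (hTi _ (hpos n)) (hTi _ (inv_pos.2 (hpos n)))] at h1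
    have e1 := hΦ.integral_scaled w x (hpos n)
    have e2 := hΦ.integral_scaled w x (inv_pos.2 (hpos n))
    rw [inv_inv] at e2
    simp only [T] at h1
    rw [e1, e2] at h1
    linarith
  have hlim : Filter.Tendsto (fun n => ∫ y, h y * P n y) Filter.atTop
      (𝓝 (-(∫ z, lap Φ z) * w x)) := by
    have h1 : Filter.Tendsto (fun n : ℕ => ∫ z, w (x + ((n : ℝ) + 1)⁻¹ • z) * lap Φ z) Filter.atTop
        (𝓝 (∫ z, w x * lap Φ z)) := by
      obtain ⟨r, hr0, hr⟩ := hΦ.lap_support.isCompact.isBounded.subset_closedBall_lt 0 0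
      obtain ⟨M, hM⟩ := (isCompact_closedBall x r).exists_bound_of_continuousOn hwc.continuousOn
      refine tendsto_integral_of_dominated_convergence (fun z => M * |lap Φ z|) ?_ ?_ ?_ ?_
      · intro n
        have := hΦ.contDiff.continuous_lap
        exact (by fun_prop : Continuous fun z =>
          w (x + ((n : ℝ) + 1)⁻¹ • z) * lap Φ z).aestronglyMeasurable
      · exact ((hΦ.contDiff.continuous_lap.integrable_of_hasCompactSupport
          hΦ.lap_support).abs).const_mul M
      · intro n
        refine Filter.Eventually.of_forall fun z => ?_
        by_cases hz : lap Φ z = 0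
        · simp [hz]
        · have hzr := hr (subset_tsupport _ hz)
          rw [norm_mul]
          refine mul_le_mul_of_nonneg_right (hM _ ?_) (abs_nonneg _)
          rw [mem_closedBall_zero_iff] at hzr
          rw [mem_closedBall, dist_eq_norm, add_sub_cancel_left, norm_smul,
            Real.norm_of_nonneg (inv_pos.2 (hpos n)).le]
          have : ((n : ℝ) + 1)⁻¹ ≤ 1 := inv_le_one_of_one_le₀ (by
            have : (0 : ℝ) ≤ n := by positivity
            linarith)
          calc _ ≤ 1 * ‖z‖ := by gcongr
            _ ≤ r := by linarith
      · refine Filter.Eventually.of_forall fun z => ?_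
        have h0 : Filter.Tendsto (fun n : ℕ => ((n : ℝ) + 1)⁻¹) Filter.atTop (𝓝 0) := by
          simpa [one_div] using tendsto_one_div_add_atTop_nhds_zero_nat (𝕜 := ℝ)
        have h2 : Filter.Tendsto (fun n : ℕ => x + ((n : ℝ) + 1)⁻¹ • z) Filter.atTop (𝓝 x) := by
          simpa using (h0.smul_const z).const_add x
        exact ((hwc.tendsto x).comp h2).mul_const _
    have h2 := h1.neg.add hM
    rw [integral_const_mul, add_zero] at h2
    simp only [hgreen]
    convert h2 using 2
    ring
  have hlint : ∀ n, ∫⁻ y, ENNReal.ofReal (h y * P n y) = ENNReal.ofReal (∫ y, h y * P n y) :=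
    fun n => (ofReal_integral_eq_lintegral_ofReal (hPint n)
      (Filter.Eventually.of_forall fun y => mul_nonneg (hh0 y) (hP0 n y))).symm
  have hconv := lintegral_tendsto_of_tendsto_of_monotone
    (μ := (volume : Measure (Euc N))) (f := fun n y => ENNReal.ofReal (h y * P n y))
    (F := fun y => ENNReal.ofReal (‖x - y‖ ^ (2 - (N : ℝ)) * h y))
    (fun n => (hhm.mul (hP n).continuous.measurable).ennreal_ofReal.aemeasurable)
    (Filter.Eventually.of_forall fun y n m hnm =>
      ENNReal.ofReal_le_ofReal (mul_le_mul_of_nonneg_left (hPm y hnm) (hh0 y)))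
    (by
      filter_upwards [ae_euc_ne hN x] with y hy
      rw [mul_comm]
      exact ENNReal.tendsto_ofReal ((hPlim y hy).const_mul (h y)))
  simp only [hlint] at hconv
  exact tendsto_nhds_unique (ENNReal.tendsto_ofReal hlim) hconv

lemma integrable_weight_mul {N : ℕ} (hN : 3 ≤ N) {a p : ℝ} (ha : -2 < a) (hp : 0 < p)
    {v : Euc N → ℝ} (hv : Continuous v) (Q : Euc N → ℝ) (hQ : Continuous Q)
    (hc : HasCompactSupport Q) : Integrable fun y => ‖y‖ ^ a * v y ^ p * Q y := by
  have h3 : (3 : ℝ) ≤ N := by exact_mod_cast hN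
  have hvp : Continuous fun y => v y ^ p := hv.rpow_const fun _ => Or.inr hp.le
  have h := integrable_norm_rpow_mul hN (s := a) (by linarith) (hvp.mul hQ) hc.mul_left
  exact h.congr (Filter.Eventually.of_forall fun y => by simp [mul_assoc])

lemma measurable_weight {N : ℕ} {a p : ℝ} {v : Euc N → ℝ} (hv : Continuous v) :
    Measurable fun y => ‖y‖ ^ a * v y ^ p :=
  (measurable_norm.pow_const a).mul (hv.measurable.pow_const p)

lemma IsProfile.tendsto_average_of_tendsto_zero {N : ℕ} (hN : 3 ≤ N) {Φ : Euc N → ℝ}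
    (hΦ : IsProfile Φ) {w : Euc N → ℝ} (hwc : Continuous w) {B : ℝ} (hB : ∀ x, |w x| ≤ B)
    (hlim : Filter.Tendsto w (Filter.cocompact (Euc N)) (𝓝 0)) (x : Euc N) :
    Filter.Tendsto (fun n : ℕ => ∫ z, w (x + ((n : ℝ) + 1) • z) * lap Φ z) Filter.atTop (𝓝 0) := by
  have hη := hΦ.contDiff.continuous_lap
  rw [← integral_zero (Euc N) ℝ (μ := volume)]
  refine tendsto_integral_of_dominated_convergence (fun z => B * |lap Φ z|) ?_ ?_ ?_ ?_
  · intro n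
    exact (by fun_prop : Continuous fun z =>
      w (x + ((n : ℝ) + 1) • z) * lap Φ z).aestronglyMeasurable
  · exact ((hη.integrable_of_hasCompactSupport hΦ.lap_support).abs).const_mul B
  · intro n
    refine Filter.Eventually.of_forall fun z => ?_
    rw [norm_mul]
    exact mul_le_mul_of_nonneg_right (hB _) (abs_nonneg _)
  · filter_upwards [ae_euc_ne hN 0] with z hz
    have hn : Filter.Tendsto (fun n : ℕ => (n : ℝ) + 1) Filter.atTop Filter.atTop :=
      Filter.tendsto_atTop_add_const_right _ _ tendsto_natCast_atTop_atTop
    have h1 : Filter.Tendsto (fun n : ℕ => x + ((n : ℝ) + 1) • z) Filter.atTop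
        (Filter.cocompact (Euc N)) := by
      rw [← Metric.cobounded_eq_cocompact, ← tendsto_norm_atTop_iff_cobounded]
      have h2 : Filter.Tendsto (fun n : ℕ => -‖x‖ + ((n : ℝ) + 1) * ‖z‖) Filter.atTop
          Filter.atTop :=
        Filter.tendsto_atTop_add_const_left _ _ (hn.atTop_mul_const (norm_pos_iff.2 hz))
      refine Filter.tendsto_atTop_mono (fun n => ?_) h2
      have h3 : ‖((n : ℝ) + 1) • z‖ = ((n : ℝ) + 1) * ‖z‖ := by
        rw [norm_smul, Real.norm_of_nonneg (by positivity)]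
      have h4 := norm_sub_le (x + ((n : ℝ) + 1) • z) x
      rw [add_sub_cancel_left, h3] at h4
      linarith
    simpa using (hlim.comp h1).mul_const (lap Φ z)

lemma le_add_rpow_mul {p ε t : ℝ} (hp : 1 ≤ p) (hε : 0 < ε) (ht : 0 ≤ t) :
    t ≤ ε + ε ^ (1 - p) * t ^ p := by
  rcases le_or_gt t ε with h | h
  · have : 0 ≤ ε ^ (1 - p) * t ^ p := by positivity
    linarith
  · have ht' : 0 < t := hε.trans h
    suffices t ≤ ε ^ (1 - p) * t ^ p by linarith
    calc t = t ^ (1 - p) * t ^ p := by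
          rw [← Real.rpow_add ht']
          simp
      _ ≤ ε ^ (1 - p) * t ^ p := by
          exact mul_le_mul_of_nonneg_right (Real.rpow_le_rpow_of_nonpos hε h.le (by linarith))
            (by positivity)

lemma rpow_le_add_rpow {r s t e : ℝ} (hr : 0 < r) (h1 : r ≤ t) (h2 : t ≤ s) :
    t ^ e ≤ r ^ e + s ^ e := by
  have ht : 0 < t := hr.trans_le h1
  have hs : 0 < s := ht.trans_le h2
  rcases le_or_gt 0 e with he | he
  · have : t ^ e ≤ s ^ e := Real.rpow_le_rpow ht.le h2 he
    have : 0 ≤ r ^ e := by positivity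
    linarith
  · have : t ^ e ≤ r ^ e := Real.rpow_le_rpow_of_nonpos hr h1 he.le
    have : 0 ≤ s ^ e := by positivity
    linarith

lemma IsProfile.tendsto_average_of_integrable {N : ℕ} {Φ : Euc N → ℝ}
    (hΦ : IsProfile Φ) {v : Euc N → ℝ} (hv0 : ∀ x, 0 ≤ v x) {a p : ℝ}
    (ha : -2 < a) (hp : 1 ≤ p)
    (hF : Integrable fun y : Euc N => ‖y‖ ^ (2 - (N : ℝ)) * (‖y‖ ^ a * v y ^ p)) (x : Euc N) :
    Filter.Tendsto (fun n : ℕ => ∫ z, v (x + ((n : ℝ) + 1) • z) * lap Φ z) Filter.atTop (𝓝 0) := by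
  have hη := hΦ.contDiff.continuous_lap
  have hηi : Integrable fun z => |lap Φ z| :=
    (hη.integrable_of_hasCompactSupport hΦ.lap_support).abs
  obtain ⟨M, hM⟩ := hη.bounded_above_of_compact_support hΦ.lap_support
  obtain ⟨r, hr0, hr⟩ := hΦ.lap_support.isCompact.isBounded.subset_closedBall_lt 0 0
  set F : Euc N → ℝ := fun y => ‖y‖ ^ (2 - (N : ℝ)) * (‖y‖ ^ a * v y ^ p) with hFdef
  have hF0 : ∀ y, 0 ≤ F y := fun y => by
    have := hv0 y
    positivity
  set A : ℝ := ∫ z, |lap Φ z| with hA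
  have hA0 : 0 ≤ A := integral_nonneg fun z => abs_nonneg _
  set e : ℝ := (N : ℝ) - 2 - a with he
  set K : ℝ := (1 / 4 : ℝ) ^ e + (r + 1) ^ e with hK
  have hM0 : 0 ≤ M := (norm_nonneg _).trans (hM 0)
  have hK0 : 0 ≤ K := by positivity
  have hn : Filter.Tendsto (fun n : ℕ => (n : ℝ) + 1) Filter.atTop Filter.atTop :=
    Filter.tendsto_atTop_add_const_right _ _ tendsto_natCast_atTop_atTop
  have main : ∀ ε : ℝ, 0 < ε → ∀ R : ℝ, 0 < R → 4 * ‖x‖ + 1 ≤ R →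
      |∫ z, v (x + R • z) * lap Φ z| ≤ ε * A + ε ^ (1 - p) * M * K * (∫ y, F y) * R ^ (-(2 + a)) := by
    intro ε hε R hR hRx
    have hFR : Integrable fun z => F (x + R • z) :=
      (hF.comp_add_left x).comp_smul hR.ne'
    have hpt : ∀ z, ‖v (x + R • z) * lap Φ z‖
        ≤ ε * |lap Φ z| + ε ^ (1 - p) * M * K * R ^ e * F (x + R • z) := by
      intro z
      have hF0' := hF0 (x + R • z)
      by_cases hz : lap Φ z = 0
      · rw [hz, mul_zero, norm_zero, abs_zero]
        positivity
      have hz1 : ‖z‖ ≤ r := by simpa using hr (subset_tsupport _ hz)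
      have hz2 : 1 / 2 ≤ ‖z‖ := by
        by_contra hlt
        exact hz (hΦ.lap_zero z (not_le.1 hlt))
      set y := x + R • z with hy
      have hRz : ‖R • z‖ = R * ‖z‖ := by rw [norm_smul, Real.norm_of_nonneg hR.le]
      have hy1 : R * (1 / 4) ≤ ‖y‖ := by
        have h4 := norm_sub_le y x
        rw [hy, add_sub_cancel_left, hRz, ← hy] at h4
        nlinarith
      have hy2 : ‖y‖ ≤ R * (r + 1) := by
        have h4 := norm_add_le x (R • z)
        rw [hRz, ← hy] at h4
        nlinarith [norm_nonneg x]
      have hypos : 0 < ‖y‖ := by linarith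
      have hvp : v y ^ p = ‖y‖ ^ e * F y := by
        rw [hFdef, he]
        simp only
        rw [← mul_assoc, ← mul_assoc, ← Real.rpow_add hypos, ← Real.rpow_add hypos]
        ring_nf
        simp
      have hye : ‖y‖ ^ e ≤ R ^ e * K := by
        have := rpow_le_add_rpow (e := e) (by positivity) hy1 hy2
        rwa [Real.mul_rpow hR.le (by positivity), Real.mul_rpow hR.le (by positivity),
          ← mul_add] at this
      rw [norm_mul, Real.norm_of_nonneg (hv0 y), Real.norm_eq_abs]
      calc v y * |lap Φ z| ≤ (ε + ε ^ (1 - p) * (‖y‖ ^ e * F y)) * |lap Φ z| := by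
            gcongr
            rw [← hvp]
            exact le_add_rpow_mul hp hε (hv0 y)
        _ = ε * |lap Φ z| + ε ^ (1 - p) * (‖y‖ ^ e * F y) * |lap Φ z| := by ring
        _ ≤ ε * |lap Φ z| + ε ^ (1 - p) * (R ^ e * K * F y) * M := by
            gcongr
            exact hM z
        _ = _ := by ring
    have hint : Integrable fun z =>
        ε * |lap Φ z| + ε ^ (1 - p) * M * K * R ^ e * F (x + R • z) :=
      (hηi.const_mul _).add (hFR.const_mul _)
    refine (norm_integral_le_of_norm_le hint (Filter.Eventually.of_forall hpt)).trans (le_of_eq ?_)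
    rw [integral_add (hηi.const_mul _) (hFR.const_mul _), integral_const_mul, integral_const_mul]
    have hI : ∫ z, F (x + R • z) = (R ^ N)⁻¹ * ∫ y, F y := by
      rw [Measure.integral_comp_smul volume (fun z => F (x + z)) R, integral_add_left_eq_self,
        finrank_euclideanSpace, Fintype.card_fin, abs_of_pos (by positivity), smul_eq_mul]
    rw [hI]
    have hRe : R ^ e * (R ^ N)⁻¹ = R ^ (-(2 + a)) := by
      rw [← Real.rpow_natCast R N, ← Real.rpow_neg hR.le, ← Real.rpow_add hR, he]
      congr 1
      ring
    rw [← hRe]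
    ring
  rw [Metric.tendsto_atTop']
  intro δ hδ
  set ε : ℝ := δ / 2 / (A + 1) with hε
  have hε0 : 0 < ε := by positivity
  set L : ℝ := ε ^ (1 - p) * M * K * (∫ y, F y) with hL
  have h0 : Filter.Tendsto (fun n : ℕ => L * ((n : ℝ) + 1) ^ (-(2 + a))) Filter.atTop (𝓝 0) := by
    simpa using ((tendsto_rpow_neg_atTop (by linarith : 0 < 2 + a)).comp hn).const_mul L
  have hev := ((h0.eventually_lt_const (show 0 < δ / 2 by positivity)).and
    (hn.eventually_ge_atTop (4 * ‖x‖ + 1)))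
  obtain ⟨n0, hn0⟩ := Filter.eventually_atTop.1 hev
  refine ⟨n0, fun n hnn => ?_⟩
  obtain ⟨h1, h2⟩ := hn0 n hnn.le
  rw [dist_zero_right, Real.norm_eq_abs]
  have h3 := main ε hε0 ((n : ℝ) + 1) (by positivity) h2
  have h4 : ε * A ≤ δ / 2 := by
    rw [hε, div_mul_eq_mul_div, div_le_iff₀ (by positivity)]
    nlinarith
  linarith

/-- The Newtonian potential (up to a constant) of a nonnegative density. -/
def newton {N : ℕ} (h : Euc N → ℝ) (x : Euc N) : ℝ≥0∞ :=
  ∫⁻ y, ENNReal.ofReal (‖x - y‖ ^ (2 - (N : ℝ)) * h y)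

lemma abs_rpow_sub_one_mul_self {t p : ℝ} (ht : 0 < t) : |t| ^ (p - 1) * t = t ^ p := by
  rw [abs_of_pos ht]
  nth_rewrite 2 [← Real.rpow_one t]
  rw [← Real.rpow_add ht]
  ring_nf

/-- A positive decaying solution solves the corresponding system of integral equations. -/
lemma IsHLESol.exists_newton {N : ℕ} (hN : 3 ≤ N) {p q a b : ℝ} (hq : 0 < q) (hp : 1 ≤ p)
    (ha : -2 < a) (hb : -2 < b) {u v : Euc N → ℝ} (hsol : IsHLESol p q a b u v)
    (hu : ∀ x, 0 < u x) (hv : ∀ x, 0 < v x) {B : ℝ} (hB : ∀ x, u x ≤ B)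
    (hlim : Filter.Tendsto u (Filter.cocompact (Euc N)) (𝓝 0)) :
    ∃ κ : ℝ, 0 < κ ∧
      (∀ x, ENNReal.ofReal (κ * u x) = newton (fun y => ‖y‖ ^ a * v y ^ p) x) ∧
      (∀ x, ENNReal.ofReal (κ * v x) = newton (fun y => ‖y‖ ^ b * u y ^ q) x) := by
  obtain ⟨hu2, hv2, huc, hvc, hequ, heqv⟩ := hsol
  obtain ⟨Φ, hΦ⟩ := exists_profile N
  have hf0 : ∀ x : Euc N, 0 ≤ ‖x‖ ^ a * v x ^ p := fun x => by
    have := hv x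
    positivity
  have hg0 : ∀ x : Euc N, 0 ≤ ‖x‖ ^ b * u x ^ q := fun x => by
    have := hu x
    positivity
  have hrepu : ∀ x, ENNReal.ofReal (-(∫ z, lap Φ z) * u x)
      = newton (fun y => ‖y‖ ^ a * v y ^ p) x := fun x =>
    hΦ.representation hN huc hu2
      (fun x hx => by rw [hequ x hx, abs_rpow_sub_one_mul_self (hv x)]) hf0
      (measurable_weight hvc) (integrable_weight_mul hN ha (by linarith) hvc) x
      (hΦ.tendsto_average_of_tendsto_zero hN huc (B := B)
        (fun x => by rw [abs_of_pos (hu x)]; exact hB x) hlim x)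
  have hFm : Measurable fun y : Euc N => ‖y‖ ^ (2 - (N : ℝ)) * (‖y‖ ^ a * v y ^ p) :=
    (measurable_norm.pow_const _).mul (measurable_weight hvc)
  have h0 := hrepu 0
  simp only [newton, zero_sub, norm_neg] at h0
  have hF : Integrable fun y : Euc N => ‖y‖ ^ (2 - (N : ℝ)) * (‖y‖ ^ a * v y ^ p) := by
    refine ⟨hFm.aestronglyMeasurable, ?_⟩
    rw [hasFiniteIntegral_iff_ofReal (Filter.Eventually.of_forall fun y =>
      mul_nonneg (by positivity) (hf0 y)), ← h0]
    exact ENNReal.ofReal_lt_top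
  have hrepv : ∀ x, ENNReal.ofReal (-(∫ z, lap Φ z) * v x)
      = newton (fun y => ‖y‖ ^ b * u y ^ q) x := fun x =>
    hΦ.representation hN hvc hv2
      (fun x hx => by rw [heqv x hx, abs_rpow_sub_one_mul_self (hu x)]) hg0
      (measurable_weight huc) (integrable_weight_mul hN hb hq huc) x
      (hΦ.tendsto_average_of_integrable (fun x => (hv x).le) ha hp hF x)
  refine ⟨-(∫ z, lap Φ z), ?_, hrepu, hrepv⟩
  have hpos : 0 < ∫⁻ y, ENNReal.ofReal (‖y‖ ^ (2 - (N : ℝ)) * (‖y‖ ^ a * v y ^ p)) := by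
    rw [pos_iff_ne_zero, Ne, lintegral_eq_zero_iff hFm.ennreal_ofReal]
    intro hz
    have hfalse : ∀ᵐ y : Euc N, False := by
      filter_upwards [hz, ae_euc_ne hN 0] with y hy hy0
      have h1 : 0 < ‖y‖ := norm_pos_iff.2 hy0
      have h2 := hv y
      have h3 : 0 < ‖y‖ ^ (2 - (N : ℝ)) * (‖y‖ ^ a * v y ^ p) := by positivity
      simp only [Pi.zero_apply, ENNReal.ofReal_eq_zero] at hy
      linarith
    have : (volume : Measure (Euc N)) = 0 := by simpa using hfalse
    exact NeZero.ne (volume : Measure (Euc N)) this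
  rw [← h0, ENNReal.ofReal_pos] at hpos
  exact pos_of_mul_pos_left hpos (hu 0).le

lemma exists_newton_le {N : ℕ} (hN : 3 ≤ N) {τ₁ τ₂ : ℝ} (h1 : 0 < τ₁) (h1' : τ₁ < (N : ℝ) - 2)
    (h2 : 0 < τ₂) (h2' : τ₂ < (N : ℝ) - 2) :
    ∃ C : ℝ, 0 ≤ C ∧ ∀ (h : Euc N → ℝ) (c₁ c₂ : ℝ), 0 ≤ c₁ → 0 ≤ c₂ →
      (∀ y, y ≠ 0 → h y ≤ c₁ * ‖y‖ ^ (-(τ₁ + 2)) + c₂ * ‖y‖ ^ (-(τ₂ + 2))) →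
      ∀ x, x ≠ 0 → newton h x ≤ ENNReal.ofReal (C * (c₁ * ‖x‖ ^ (-τ₁) + c₂ * ‖x‖ ^ (-τ₂))) := by
  obtain ⟨C₁, hC₁, hr₁⟩ := exists_riesz_le hN (σ := 2) (A := τ₁ + 2) (by norm_num) (by linarith)
    (by linarith)
  obtain ⟨C₂, hC₂, hr₂⟩ := exists_riesz_le hN (σ := 2) (A := τ₂ + 2) (by norm_num) (by linarith)
    (by linarith)
  refine ⟨C₁ + C₂, by positivity, fun h c₁ c₂ hc₁ hc₂ hh x hx => ?_⟩
  have e₁ : (2 : ℝ) - (τ₁ + 2) = -τ₁ := by ring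
  have e₂ : (2 : ℝ) - (τ₂ + 2) = -τ₂ := by ring
  have k₁ := hr₁ x hx
  have k₂ := hr₂ x hx
  rw [e₁] at k₁
  rw [e₂] at k₂
  have hm : ∀ t : ℝ, Measurable fun y : Euc N =>
      ENNReal.ofReal (‖x - y‖ ^ (2 - (N : ℝ)) * ‖y‖ ^ (-t)) := fun t =>
    (((measurable_const.sub measurable_id).norm.pow_const _).mul
      (measurable_norm.pow_const _)).ennreal_ofReal
  calc newton h x ≤ ∫⁻ y, (ENNReal.ofReal c₁ *
          ENNReal.ofReal (‖x - y‖ ^ (2 - (N : ℝ)) * ‖y‖ ^ (-(τ₁ + 2)))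
        + ENNReal.ofReal c₂ *
          ENNReal.ofReal (‖x - y‖ ^ (2 - (N : ℝ)) * ‖y‖ ^ (-(τ₂ + 2)))) := by
        refine lintegral_mono_ae ?_
        filter_upwards [ae_euc_ne hN 0] with y hy
        rw [← ENNReal.ofReal_mul hc₁, ← ENNReal.ofReal_mul hc₂,
          ← ENNReal.ofReal_add (by positivity) (by positivity)]
        refine ENNReal.ofReal_le_ofReal ?_
        calc _ ≤ ‖x - y‖ ^ (2 - (N : ℝ)) * (c₁ * ‖y‖ ^ (-(τ₁ + 2)) + c₂ * ‖y‖ ^ (-(τ₂ + 2))) := by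
              gcongr
              exact hh y hy
          _ = _ := by ring
    _ = ENNReal.ofReal c₁ *
          (∫⁻ y, ENNReal.ofReal (‖x - y‖ ^ (2 - (N : ℝ)) * ‖y‖ ^ (-(τ₁ + 2))))
        + ENNReal.ofReal c₂ *
          (∫⁻ y, ENNReal.ofReal (‖x - y‖ ^ (2 - (N : ℝ)) * ‖y‖ ^ (-(τ₂ + 2)))) := by
        rw [lintegral_add_left ((hm _).const_mul _), lintegral_const_mul _ (hm _),
          lintegral_const_mul _ (hm _)]
    _ ≤ ENNReal.ofReal c₁ * ENNReal.ofReal (C₁ * ‖x‖ ^ (-τ₁))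
        + ENNReal.ofReal c₂ * ENNReal.ofReal (C₂ * ‖x‖ ^ (-τ₂)) := by gcongr
    _ = ENNReal.ofReal (c₁ * (C₁ * ‖x‖ ^ (-τ₁)) + c₂ * (C₂ * ‖x‖ ^ (-τ₂))) := by
        rw [← ENNReal.ofReal_mul hc₁, ← ENNReal.ofReal_mul hc₂,
          ← ENNReal.ofReal_add (by positivity) (by positivity)]
    _ ≤ _ := by
        refine ENNReal.ofReal_le_ofReal ?_
        have t₁ : 0 ≤ ‖x‖ ^ (-τ₁) := by positivity
        have t₂ : 0 ≤ ‖x‖ ^ (-τ₂) := by positivity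
        have := mul_nonneg hC₂ (mul_nonneg hc₁ t₁)
        have := mul_nonneg hC₁ (mul_nonneg hc₂ t₂)
        linarith

lemma exists_rpow_bound_of_decay {N : ℕ} {w : Euc N → ℝ} {B C R τ σ : ℝ} (hB : ∀ x, w x ≤ B)
    (hw : ∀ x, 0 < w x) (hC : 0 ≤ C) (hdec : ∀ x, R ≤ ‖x‖ → w x ≤ C * ‖x‖ ^ (-τ))
    (hσ : 0 ≤ σ) (hστ : σ ≤ τ) : ∃ D : ℝ, 0 < D ∧ ∀ x, x ≠ 0 → w x ≤ D * ‖x‖ ^ (-σ) := by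
  set S := max R 1 with hS
  have hS1 : 1 ≤ S := le_max_right _ _
  have hB0 : 0 < B := (hw 0).trans_le (hB 0)
  refine ⟨C + B * S ^ σ, by positivity, fun x hx => ?_⟩
  have hx0 : 0 < ‖x‖ := norm_pos_iff.2 hx
  have t0 : 0 < ‖x‖ ^ (-σ) := by positivity
  rcases le_or_gt S ‖x‖ with h | h
  · have h1 := hdec x ((le_max_left _ _).trans h)
    have h2 : ‖x‖ ^ (-τ) ≤ ‖x‖ ^ (-σ) :=
      Real.rpow_le_rpow_of_exponent_le (hS1.trans h) (by linarith)
    calc w x ≤ C * ‖x‖ ^ (-σ) := h1.trans (by gcongr)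
      _ ≤ _ := by
        gcongr
        have : 0 ≤ B * S ^ σ := by positivity
        linarith
  · have h2 : 1 ≤ S ^ σ * ‖x‖ ^ (-σ) := by
      rw [Real.rpow_neg hx0.le, ← div_eq_mul_inv, one_le_div (by positivity)]
      exact Real.rpow_le_rpow hx0.le h.le hσ
    calc w x ≤ B * 1 := by rw [mul_one]; exact hB x
      _ ≤ B * (S ^ σ * ‖x‖ ^ (-σ)) := by gcongr
      _ ≤ _ := by
        have : 0 ≤ C * ‖x‖ ^ (-σ) := by positivity
        linarith

lemma exists_tail_lt {N : ℕ} {G : Euc N → ℝ≥0∞} (hG : Measurable G) (hfin : ∫⁻ x, G x < ⊤)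
    {η : ℝ≥0∞} (hη : 0 < η) : ∃ R : ℝ, 0 < R ∧ ∫⁻ x in (ball (0 : Euc N) R)ᶜ, G x < η := by
  have h : Filter.Tendsto (fun n : ℕ => ∫⁻ x, (ball (0 : Euc N) n)ᶜ.indicator G x) Filter.atTop
      (𝓝 (∫⁻ _ : Euc N, 0)) := by
    refine tendsto_lintegral_of_dominated_convergence G
      (fun n => hG.indicator measurableSet_ball.compl)
      (fun n => Filter.Eventually.of_forall fun x => indicator_le_self _ _ _) hfin.ne
      (Filter.Eventually.of_forall fun x => ?_)
    refine tendsto_const_nhds.congr' ?_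
    obtain ⟨n0, hn0⟩ := exists_nat_gt ‖x‖
    filter_upwards [Filter.eventually_ge_atTop n0] with n hn
    have : (n0 : ℝ) ≤ n := by exact_mod_cast hn
    rw [indicator_of_notMem]
    simp only [mem_compl_iff, mem_ball_zero_iff, not_not]
    linarith
  rw [lintegral_zero] at h
  obtain ⟨n, hn, hn1⟩ := ((h.eventually_lt_const hη).and (Filter.eventually_ge_atTop 1)).exists
  refine ⟨n, by exact_mod_cast hn1, ?_⟩
  rwa [lintegral_indicator measurableSet_ball.compl] at hn

/-- A Harnack-type estimate for Newtonian potentials of slowly decaying densities. -/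
lemma exists_newton_harnack {N : ℕ} (hN : 3 ≤ N) {α c : ℝ} (hα : 0 < α) (hc : 0 ≤ c)
    {h : Euc N → ℝ} (hh0 : ∀ y, 0 ≤ h y) (hh : ∀ y, y ≠ 0 → h y ≤ c * ‖y‖ ^ (-(α + 2))) :
    ∃ C : ℝ, 0 ≤ C ∧ ∀ δ : ℝ, 0 < δ → δ ≤ 1 / 4 → ∀ x, x ≠ 0 → ∀ z ∈ ball x (δ * ‖x‖),
      newton h x ≤ ENNReal.ofReal (C * δ ^ 2 * ‖x‖ ^ (-α)) +
        ENNReal.ofReal ((3 / 2) ^ ((N : ℝ) - 2)) * newton h z := by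
  obtain ⟨C₃, hC₃, h3⟩ := exists_lintegral_ball_sub_rpow_le hN (s := (N : ℝ) - 2) (by linarith)
  refine ⟨c * 2 ^ (α + 2) * (C₃ * 4), by positivity, fun δ hδ hδ4 x hx z hz => ?_⟩
  have hx0 : 0 < ‖x‖ := norm_pos_iff.2 hx
  set r := δ * ‖x‖ with hr
  have hr0 : 0 < r := by positivity
  have hrx : 2 * r ≤ ‖x‖ / 2 := by nlinarith
  have hN2 : (2 : ℝ) - N ≤ 0 := by
    have : (3 : ℝ) ≤ N := by exact_mod_cast hN
    linarith
  rw [newton, ← lintegral_add_compl _ (measurableSet_ball (x := x) (ε := 2 * r))]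
  refine add_le_add ?_ ?_
  · calc ∫⁻ y in ball x (2 * r), ENNReal.ofReal (‖x - y‖ ^ (2 - (N : ℝ)) * h y)
        ≤ ∫⁻ y in ball x (2 * r), ENNReal.ofReal (c * (‖x‖ / 2) ^ (-(α + 2))) *
          ENNReal.ofReal (‖x - y‖ ^ (-((N : ℝ) - 2))) := by
          refine setLIntegral_mono' measurableSet_ball fun y hy => ?_
          rw [← ENNReal.ofReal_mul (by positivity)]
          refine ENNReal.ofReal_le_ofReal ?_
          rw [mem_ball, dist_eq_norm] at hy
          have hy1 : ‖x‖ / 2 ≤ ‖y‖ := by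
            have := norm_sub_norm_le x y
            rw [norm_sub_rev] at this
            linarith
          have hy0 : y ≠ 0 := norm_pos_iff.1 (by linarith)
          rw [neg_sub, mul_comm]
          refine mul_le_mul_of_nonneg_right ((hh y hy0).trans ?_) (by positivity)
          exact mul_le_mul_of_nonneg_left
            (Real.rpow_le_rpow_of_nonpos (by positivity) hy1 (by linarith)) hc
      _ ≤ ENNReal.ofReal (c * (‖x‖ / 2) ^ (-(α + 2))) *
          ENNReal.ofReal (C₃ * (2 * r) ^ ((N : ℝ) - ((N : ℝ) - 2))) := by
          rw [lintegral_const_mul' _ _ ENNReal.ofReal_ne_top]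
          gcongr
          exact h3 (2 * r) (by positivity) x
      _ = _ := by
          rw [← ENNReal.ofReal_mul (by positivity)]
          congr 1
          have e1 : (N : ℝ) - ((N : ℝ) - 2) = (2 : ℕ) := by
            push_cast
            ring
          have e2 : ‖x‖ ^ (-(α + 2)) * ‖x‖ ^ 2 = ‖x‖ ^ (-α) := by
            rw [← Real.rpow_natCast ‖x‖ 2, ← Real.rpow_add hx0]
            congr 1
            push_cast
            ring
          rw [e1, Real.rpow_natCast, Real.div_rpow hx0.le (by norm_num), Real.rpow_neg (by norm_num : (0:ℝ) ≤ 2),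
            ← e2, hr]
          field_simp
          ring
  · rw [newton, ← lintegral_const_mul' _ _ ENNReal.ofReal_ne_top]
    refine le_trans ?_ (setLIntegral_le_lintegral (ball x (2 * r))ᶜ _)
    refine setLIntegral_mono' measurableSet_ball.compl fun y hy => ?_
    rw [← ENNReal.ofReal_mul (by positivity), ← mul_assoc]
    refine ENNReal.ofReal_le_ofReal (mul_le_mul_of_nonneg_right ?_ (hh0 y))
    rw [mem_compl_iff, mem_ball, dist_eq_norm, not_lt, norm_sub_rev] at hy
    rw [mem_ball, dist_eq_norm] at hz
    have h1 : ‖z - y‖ ≤ ‖z - x‖ + ‖x - y‖ := norm_sub_le_norm_sub_add_norm_sub z x y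
    have h2 : ‖x - y‖ ≤ ‖z - x‖ + ‖z - y‖ := by
      rw [norm_sub_rev z x]
      exact norm_sub_le_norm_sub_add_norm_sub x z y
    have hzy : 0 < ‖z - y‖ := by linarith
    have h4 : 2 / 3 * ‖z - y‖ ≤ ‖x - y‖ := by linarith
    calc ‖x - y‖ ^ (2 - (N : ℝ)) ≤ (2 / 3 * ‖z - y‖) ^ (2 - (N : ℝ)) :=
          Real.rpow_le_rpow_of_nonpos (by positivity) h4 hN2
      _ = _ := by
          rw [Real.mul_rpow (by norm_num) hzy.le, show (2 : ℝ) / 3 = (3 / 2)⁻¹ by norm_num,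
            Real.inv_rpow (by norm_num), ← Real.rpow_neg (by norm_num), neg_sub]

/-- A potential of a slowly decaying density that is small in the scale-invariant Lebesgue norm
decays faster than its scaling rate. -/
lemma exists_le_of_lintegral_lt_top {N : ℕ} (hN : 3 ≤ N) {α κ c : ℝ} (hα : 0 < α) (hκ : 0 < κ)
    (hc : 0 ≤ c) {u h : Euc N → ℝ} (hu : ∀ x, 0 < u x) (huc : Continuous u)
    (hrep : ∀ x, ENNReal.ofReal (κ * u x) = newton h x)
    (hh0 : ∀ y, 0 ≤ h y) (hh : ∀ y, y ≠ 0 → h y ≤ c * ‖y‖ ^ (-(α + 2)))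
    (hint : ∫⁻ x, ENNReal.ofReal (u x ^ ((N : ℝ) / α)) < ⊤) {ε : ℝ} (hε : 0 < ε) :
    ∃ R : ℝ, 0 < R ∧ ∀ x, R ≤ ‖x‖ → u x ≤ ε * ‖x‖ ^ (-α) := by
  obtain ⟨C, hC, hH⟩ := exists_newton_harnack hN hα hc hh0 hh
  set L : ℝ := (3 / 2) ^ ((N : ℝ) - 2) with hL
  have hL0 : 0 < L := by positivity
  obtain ⟨δ, hδ0, hδ4, hδ⟩ : ∃ δ : ℝ, 0 < δ ∧ δ ≤ 1 / 4 ∧ C * δ ^ 2 ≤ κ * ε / 2 := by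
    refine ⟨min (1 / 4) (κ * ε / (2 * (C + 1))), by positivity, min_le_left _ _, ?_⟩
    set δ := min (1 / 4) (κ * ε / (2 * (C + 1))) with hd
    have h0 : 0 < δ := by positivity
    have h1 : δ ≤ 1 / 4 := min_le_left _ _
    have h2 : δ ≤ κ * ε / (2 * (C + 1)) := min_le_right _ _
    rw [le_div_iff₀ (by positivity)] at h2
    have h3 : δ ^ 2 ≤ δ := by nlinarith
    have := mul_le_mul_of_nonneg_left h3 hC
    nlinarith
  have hNα : 0 < (N : ℝ) / α := by
    have : 0 < N := by omega
    positivity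
  set η : ℝ≥0∞ := ENNReal.ofReal ((ε / (2 * L)) ^ ((N : ℝ) / α) * δ ^ N) *
    volume (ball (0 : Euc N) 1) with hη
  have hη0 : 0 < η := by
    refine ENNReal.mul_pos ?_ (measure_ball_pos _ _ one_pos).ne'
    exact (ENNReal.ofReal_pos.2 (by positivity)).ne'
  obtain ⟨R, hR, hRt⟩ := exists_tail_lt
    ((huc.measurable.pow_const ((N : ℝ) / α)).ennreal_ofReal) hint hη0
  refine ⟨2 * R, by positivity, fun x hx => ?_⟩
  by_contra! hcon
  have hx0 : 0 < ‖x‖ := by linarith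
  have hz : ∀ z ∈ ball x (δ * ‖x‖), ε / (2 * L) * ‖x‖ ^ (-α) ≤ u z := by
    intro z hz
    have h1 := hH δ hδ0 hδ4 x (norm_pos_iff.1 hx0) z hz
    have huz := hu z
    rw [← hrep, ← hrep, ← ENNReal.ofReal_mul hL0.le,
      ← ENNReal.ofReal_add (by positivity) (by positivity),
      ENNReal.ofReal_le_ofReal_iff (by positivity)] at h1
    have t0 : 0 < ‖x‖ ^ (-α) := by positivity
    have h2 := mul_le_mul_of_nonneg_right hδ t0.le
    have h3 := mul_lt_mul_of_pos_left hcon hκ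
    have h4 : κ * (ε / 2 * ‖x‖ ^ (-α)) ≤ κ * (L * u z) := by linarith
    have h5 := le_of_mul_le_mul_left h4 hκ
    rw [show ε / (2 * L) * ‖x‖ ^ (-α) = (ε / 2 * ‖x‖ ^ (-α)) / L by field_simp,
      div_le_iff₀ hL0]
    linarith
  have hsub : ball x (δ * ‖x‖) ⊆ (ball (0 : Euc N) R)ᶜ := by
    intro z hz
    rw [mem_ball, dist_eq_norm, norm_sub_rev] at hz
    rw [mem_compl_iff, mem_ball_zero_iff, not_lt]
    have := norm_sub_norm_le x z
    nlinarith
  refine absurd hRt (not_lt.2 ?_)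
  refine le_trans ?_ (lintegral_mono_set hsub)
  calc η = ∫⁻ _ in ball x (δ * ‖x‖),
        ENNReal.ofReal ((ε / (2 * L) * ‖x‖ ^ (-α)) ^ ((N : ℝ) / α)) := by
        rw [setLIntegral_const, Measure.addHaar_ball_of_pos _ _ (by positivity), hη, ← mul_assoc,
          ← ENNReal.ofReal_mul (by positivity), finrank_euclideanSpace_fin,
          Real.mul_rpow (by positivity) (by positivity), ← Real.rpow_mul hx0.le,
          show -α * ((N : ℝ) / α) = -(N : ℝ) by field_simp, Real.rpow_neg hx0.le,
          Real.rpow_natCast, mul_pow]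
        congr 2
        field_simp
    _ ≤ _ := by
        refine setLIntegral_mono' measurableSet_ball fun z hzb => ENNReal.ofReal_le_ofReal ?_
        exact Real.rpow_le_rpow (by positivity) (hz z hzb) hNα.le

lemma add_rpow_le_two_rpow_mul {s t p : ℝ} (hs : 0 ≤ s) (ht : 0 ≤ t) (hp : 0 ≤ p) :
    (s + t) ^ p ≤ 2 ^ p * (s ^ p + t ^ p) := by
  have h : ∀ x y : ℝ, 0 ≤ x → x ≤ y → (x + y) ^ p ≤ 2 ^ p * (x ^ p + y ^ p) := by
    intro x y hx hxy
    have hy : 0 ≤ y := hx.trans hxy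
    calc (x + y) ^ p ≤ (2 * y) ^ p := Real.rpow_le_rpow (by positivity) (by linarith) hp
      _ = 2 ^ p * y ^ p := Real.mul_rpow (by norm_num) hy
      _ ≤ _ := by
        gcongr
        have : 0 ≤ x ^ p := by positivity
        linarith
  rcases le_total s t with h1 | h1
  · exact h s t hs h1
  · rw [add_comm, add_comm (s ^ p)]
    exact h t s ht h1

/-- One step of the bootstrap improving the decay of `u`. -/
lemma exists_decay_step {N : ℕ} (hN : 3 ≤ N) {p q a b κ α β m k B : ℝ} (hp : 1 ≤ p) (hq : 0 < q)
    (hpq : 1 < p * q) (hb : -2 < b) (hκ : 0 < κ) {u v : Euc N → ℝ}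
    (hu : ∀ x, 0 < u x) (hv : ∀ x, 0 < v x)
    (hru : ∀ x, ENNReal.ofReal (κ * u x) = newton (fun y => ‖y‖ ^ a * v y ^ p) x)
    (hrv : ∀ x, ENNReal.ofReal (κ * v x) = newton (fun y => ‖y‖ ^ b * u y ^ q) x)
    (hα : 0 < α) (hβ : 0 < β) (hβα : p * β = α + 2 + a) (hαβ : q * α = β + 2 + b)
    (hαm : α < m) (hm : m < N - 2) (hkm : p * k = m + 2 + a) (hk : k < N - 2)
    (hB : ∀ x, u x ≤ B) :
    ∃ K : ℝ, 0 ≤ K ∧ ∀ ε R : ℝ, 0 < ε → 0 < R → (∀ x, R ≤ ‖x‖ → u x ≤ ε * ‖x‖ ^ (-α)) →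
      ∃ G : ℝ, 0 ≤ G ∧ ∀ c A : ℝ, 0 < c → 0 ≤ A →
        (∀ x, x ≠ 0 → u x ≤ A * (‖x‖ ^ (-m) + c * ‖x‖ ^ (-α))) →
        ∀ x, x ≠ 0 →
          u x ≤ (G + K * ε ^ (p * q - 1) * A) * (‖x‖ ^ (-m) + c * ‖x‖ ^ (-α)) := by
  have hp0 : 0 < p := by linarith
  have hβk : β < k := by nlinarith
  have hB0 : 0 < B := (hu 0).trans_le (hB 0)
  obtain ⟨C₁, hC₁, hn₁⟩ := exists_newton_le hN (τ₁ := k) (τ₂ := β) (by linarith) hk hβ (by linarith)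
  obtain ⟨C₂, hC₂, hn₂⟩ := exists_newton_le hN (τ₁ := m) (τ₂ := α) (by linarith) hm hα (by linarith)
  set C₃ : ℝ := (C₁ / κ) ^ p * 4 ^ p with hC₃
  have hC₃0 : 0 ≤ C₃ := by positivity
  refine ⟨C₂ * C₃ / κ, by positivity, fun ε R hε hR hsm => ?_⟩
  set G : ℝ := B ^ q * R ^ (b + k + 2) with hG
  have hG0 : 0 ≤ G := by positivity
  refine ⟨C₂ * C₃ / κ * G ^ p, by positivity, fun c A hc hA hP => ?_⟩
  set θ : ℝ := q - 1 / p with hθ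
  have hθ0 : 0 < θ := by
    rw [hθ, sub_pos, div_lt_iff₀ hp0]
    linarith
  set X : ℝ := ε ^ θ * A ^ (1 / p) with hX
  have hX0 : 0 ≤ X := by positivity
  have hXp : X ^ p = ε ^ (p * q - 1) * A := by
    rw [hX, Real.mul_rpow (by positivity) (by positivity), ← Real.rpow_mul hε.le,
      ← Real.rpow_mul hA, one_div_mul_cancel hp0.ne', Real.rpow_one]
    congr 2
    rw [hθ]
    field_simp
  have hcp : (c ^ (1 / p)) ^ p = c := by
    rw [← Real.rpow_mul hc.le, one_div_mul_cancel hp0.ne', Real.rpow_one]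
  have hg : ∀ y, y ≠ 0 → ‖y‖ ^ b * u y ^ q ≤
      (G + X) * ‖y‖ ^ (-(k + 2)) + X * c ^ (1 / p) * ‖y‖ ^ (-(β + 2)) := by
    intro y hy
    have hy0 : 0 < ‖y‖ := norm_pos_iff.2 hy
    have huy := hu y
    rcases le_or_gt R ‖y‖ with hRy | hRy
    · have h1 : u y ^ θ ≤ ε ^ θ * ‖y‖ ^ (-(α * θ)) := by
        refine (Real.rpow_le_rpow huy.le (hsm y hRy) hθ0.le).trans_eq ?_
        rw [Real.mul_rpow hε.le (by positivity), ← Real.rpow_mul hy0.le, neg_mul]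
      have h2 : u y ^ (1 / p) ≤
          A ^ (1 / p) * (‖y‖ ^ (-(m / p)) + c ^ (1 / p) * ‖y‖ ^ (-(α / p))) := by
        refine (Real.rpow_le_rpow huy.le (hP y hy) (by positivity)).trans ?_
        rw [Real.mul_rpow hA (by positivity)]
        gcongr
        refine (Real.rpow_add_le_add_rpow (by positivity) (by positivity) (by positivity)
          ((div_le_one hp0).2 hp)).trans_eq ?_
        rw [Real.mul_rpow hc.le (by positivity), ← Real.rpow_mul hy0.le, ← Real.rpow_mul hy0.le]
        congr 3
        · ring
        · ring
      have e1 : ‖y‖ ^ (-(k + 2)) = ‖y‖ ^ b * ‖y‖ ^ (-(α * θ)) * ‖y‖ ^ (-(m / p)) := by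
        rw [← Real.rpow_add hy0, ← Real.rpow_add hy0]
        congr 1
        rw [hθ]
        field_simp
        linear_combination (-1 : ℝ) * hkm + hβα + p * hαβ
      have e2 : ‖y‖ ^ (-(β + 2)) = ‖y‖ ^ b * ‖y‖ ^ (-(α * θ)) * ‖y‖ ^ (-(α / p)) := by
        rw [← Real.rpow_add hy0, ← Real.rpow_add hy0]
        congr 1
        rw [hθ]
        field_simp
        linear_combination p * hαβ
      calc ‖y‖ ^ b * u y ^ q = ‖y‖ ^ b * (u y ^ θ * u y ^ (1 / p)) := by
            rw [← Real.rpow_add huy, hθ, sub_add_cancel]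
        _ ≤ ‖y‖ ^ b * (ε ^ θ * ‖y‖ ^ (-(α * θ)) *
            (A ^ (1 / p) * (‖y‖ ^ (-(m / p)) + c ^ (1 / p) * ‖y‖ ^ (-(α / p))))) := by gcongr
        _ = X * ‖y‖ ^ (-(k + 2)) + X * c ^ (1 / p) * ‖y‖ ^ (-(β + 2)) := by
            rw [e1, e2, hX]
            ring
        _ ≤ _ := by
            gcongr
            linarith
    · have h1 : ‖y‖ ^ b ≤ R ^ (b + k + 2) * ‖y‖ ^ (-(k + 2)) := by
        calc ‖y‖ ^ b = ‖y‖ ^ (b + k + 2) * ‖y‖ ^ (-(k + 2)) := by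
              rw [← Real.rpow_add hy0]
              congr 1
              ring
          _ ≤ _ := by
              gcongr
              linarith
      calc ‖y‖ ^ b * u y ^ q ≤ R ^ (b + k + 2) * ‖y‖ ^ (-(k + 2)) * B ^ q := by
            gcongr
            exact hB y
        _ = G * ‖y‖ ^ (-(k + 2)) := by
            rw [hG]
            ring
        _ ≤ _ := by
            have h3 : 0 ≤ X * ‖y‖ ^ (-(k + 2)) := by positivity
            have h4 : 0 ≤ X * c ^ (1 / p) * ‖y‖ ^ (-(β + 2)) := by positivity
            linarith
  have hvle : ∀ x, x ≠ 0 → v x ≤ C₁ / κ *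
      ((G + X) * ‖x‖ ^ (-k) + X * c ^ (1 / p) * ‖x‖ ^ (-β)) := by
    intro x hx
    have h1 := hn₁ _ (G + X) (X * c ^ (1 / p)) (by positivity) (by positivity) hg x hx
    rw [← hrv, ENNReal.ofReal_le_ofReal_iff (by positivity)] at h1
    rw [div_mul_eq_mul_div, le_div_iff₀ hκ]
    linarith
  have hf : ∀ x, x ≠ 0 → ‖x‖ ^ a * v x ^ p ≤ C₃ * (G ^ p + X ^ p) * ‖x‖ ^ (-(m + 2)) +
      C₃ * (G ^ p + X ^ p) * c * ‖x‖ ^ (-(α + 2)) := by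
    intro x hx
    have hx0 : 0 < ‖x‖ := norm_pos_iff.2 hx
    have e1 : ‖x‖ ^ (-(m + 2)) = ‖x‖ ^ a * (‖x‖ ^ (-k)) ^ p := by
      rw [← Real.rpow_mul hx0.le, ← Real.rpow_add hx0]
      congr 1
      linear_combination hkm
    have e2 : ‖x‖ ^ (-(α + 2)) = ‖x‖ ^ a * (‖x‖ ^ (-β)) ^ p := by
      rw [← Real.rpow_mul hx0.le, ← Real.rpow_add hx0]
      congr 1
      linear_combination hβα
    have h2p : (1 : ℝ) ≤ 2 ^ p := Real.one_le_rpow (by norm_num) hp0.le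
    have h4p : (4 : ℝ) ^ p = 2 ^ p * 2 ^ p := by
      rw [← Real.mul_rpow (by norm_num) (by norm_num)]
      norm_num
    have h1 : ((G + X) * ‖x‖ ^ (-k) + X * c ^ (1 / p) * ‖x‖ ^ (-β)) ^ p ≤
        4 ^ p * ((G ^ p + X ^ p) * ((‖x‖ ^ (-k)) ^ p + c * (‖x‖ ^ (-β)) ^ p)) := by
      set s := (‖x‖ ^ (-k)) ^ p with hs
      set t := (‖x‖ ^ (-β)) ^ p with ht
      have hs0 : 0 ≤ s := by positivity
      have ht0 : 0 ≤ t := by positivity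
      calc _ ≤ 2 ^ p * (((G + X) * ‖x‖ ^ (-k)) ^ p + (X * c ^ (1 / p) * ‖x‖ ^ (-β)) ^ p) :=
            add_rpow_le_two_rpow_mul (by positivity) (by positivity) hp0.le
        _ = 2 ^ p * ((G + X) ^ p * s + X ^ p * c * t) := by
            rw [Real.mul_rpow (by positivity) (by positivity),
              Real.mul_rpow (by positivity) (by positivity),
              Real.mul_rpow (by positivity) (by positivity), hcp]
        _ ≤ 2 ^ p * (2 ^ p * (G ^ p + X ^ p) * s + 2 ^ p * (G ^ p + X ^ p) * (c * t)) := by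
            gcongr ?_ * (?_ * _ + ?_)
            · exact add_rpow_le_two_rpow_mul hG0 hX0 hp0.le
            · rw [mul_assoc]
              gcongr
              have hGp : 0 ≤ G ^ p := by positivity
              have hXp' : 0 ≤ X ^ p := by positivity
              nlinarith
        _ = _ := by
            rw [h4p]
            ring
    calc ‖x‖ ^ a * v x ^ p
        ≤ ‖x‖ ^ a * (C₁ / κ * ((G + X) * ‖x‖ ^ (-k) + X * c ^ (1 / p) * ‖x‖ ^ (-β))) ^ p := by
          have := (hv x).le
          gcongr
          exact hvle x hx
      _ = ‖x‖ ^ a * ((C₁ / κ) ^ p *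
          ((G + X) * ‖x‖ ^ (-k) + X * c ^ (1 / p) * ‖x‖ ^ (-β)) ^ p) := by
          rw [Real.mul_rpow (by positivity) (by positivity)]
      _ ≤ ‖x‖ ^ a * ((C₁ / κ) ^ p *
          (4 ^ p * ((G ^ p + X ^ p) * ((‖x‖ ^ (-k)) ^ p + c * (‖x‖ ^ (-β)) ^ p)))) := by gcongr
      _ = _ := by
          rw [e1, e2, hC₃]
          ring
  intro x hx
  have h1 := hn₂ _ _ _ (by positivity) (by positivity) hf x hx
  rw [← hru, ENNReal.ofReal_le_ofReal_iff (by positivity), hXp] at h1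
  rw [← mul_le_mul_iff_right₀ hκ]
  refine h1.trans_eq ?_
  field_simp

/-- Improved decay of `u` from smallness at the scaling rate. -/
lemma exists_fast_decay {N : ℕ} (hN : 3 ≤ N) {p q a b κ α β m k B D : ℝ} (hp : 1 ≤ p) (hq : 0 < q)
    (hpq : 1 < p * q) (hb : -2 < b) (hκ : 0 < κ) {u v : Euc N → ℝ}
    (hu : ∀ x, 0 < u x) (hv : ∀ x, 0 < v x)
    (hru : ∀ x, ENNReal.ofReal (κ * u x) = newton (fun y => ‖y‖ ^ a * v y ^ p) x)
    (hrv : ∀ x, ENNReal.ofReal (κ * v x) = newton (fun y => ‖y‖ ^ b * u y ^ q) x)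
    (hα : 0 < α) (hβ : 0 < β) (hβα : p * β = α + 2 + a) (hαβ : q * α = β + 2 + b)
    (hαm : α < m) (hm : m < N - 2) (hkm : p * k = m + 2 + a) (hk : k < N - 2)
    (hB : ∀ x, u x ≤ B) (hD0 : 0 ≤ D) (hD : ∀ x, x ≠ 0 → u x ≤ D * ‖x‖ ^ (-α))
    (hsm : ∀ ε : ℝ, 0 < ε → ∃ R : ℝ, 0 < R ∧ ∀ x, R ≤ ‖x‖ → u x ≤ ε * ‖x‖ ^ (-α)) :
    ∃ C : ℝ, 0 ≤ C ∧ ∀ x, x ≠ 0 → u x ≤ C * ‖x‖ ^ (-m) := by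
  obtain ⟨K, hK, hstep⟩ := exists_decay_step hN hp hq hpq hb hκ hu hv hru hrv hα hβ hβα hαβ hαm hm
    hkm hk hB
  set ε : ℝ := (1 / (2 * (K + 1))) ^ (1 / (p * q - 1)) with hε
  have hε0 : 0 < ε := by positivity
  have hKε : K * ε ^ (p * q - 1) ≤ 1 / 2 := by
    rw [hε, ← Real.rpow_mul (by positivity), one_div_mul_cancel (by linarith), Real.rpow_one,
      mul_one_div, div_le_div_iff₀ (by positivity) (by norm_num)]
    linarith
  obtain ⟨R, hR, hRε⟩ := hsm ε hε0
  obtain ⟨G, hG, hGs⟩ := hstep ε R hε0 hR hRε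
  have hiter : ∀ c : ℝ, 0 < c → ∀ n : ℕ, ∀ x, x ≠ 0 →
      u x ≤ (2 * G + D / c / 2 ^ n) * (‖x‖ ^ (-m) + c * ‖x‖ ^ (-α)) := by
    intro c hc n
    induction n with
    | zero =>
      intro x hx
      refine (hD x hx).trans ?_
      have t1 : 0 ≤ ‖x‖ ^ (-m) := by positivity
      have t2 : 0 ≤ ‖x‖ ^ (-α) := by positivity
      calc D * ‖x‖ ^ (-α) = D / c * (c * ‖x‖ ^ (-α)) := by field_simp
        _ ≤ _ := by
          gcongr
          · rw [pow_zero, div_one]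
            linarith
          · linarith
    | succ n ih =>
      intro x hx
      refine (hGs c _ hc (by positivity) ih x hx).trans
        (mul_le_mul_of_nonneg_right ?_ (by positivity))
      have h0 : 0 ≤ 2 * G + D / c / 2 ^ n := by positivity
      have h1 := mul_le_mul_of_nonneg_right hKε h0
      have h2 : D / c / 2 ^ (n + 1) = D / c / 2 ^ n / 2 := by
        rw [pow_succ]
        field_simp
      rw [h2]
      linarith
  have hlim : ∀ c : ℝ, 0 < c → ∀ x, x ≠ 0 → u x ≤ 2 * G * (‖x‖ ^ (-m) + c * ‖x‖ ^ (-α)) := by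
    intro c hc x hx
    have h1 : Filter.Tendsto (fun n : ℕ => (2 * G + D / c / 2 ^ n) *
        (‖x‖ ^ (-m) + c * ‖x‖ ^ (-α))) Filter.atTop
        (𝓝 ((2 * G + 0) * (‖x‖ ^ (-m) + c * ‖x‖ ^ (-α)))) := by
      refine (Filter.Tendsto.const_add _ ?_).mul_const _
      exact Filter.Tendsto.div_atTop tendsto_const_nhds
        (tendsto_pow_atTop_atTop_of_one_lt (by norm_num))
    rw [add_zero] at h1
    exact ge_of_tendsto' h1 fun n => hiter c hc n x hx
  refine ⟨2 * G, by positivity, fun x hx => ?_⟩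
  have h1 : Filter.Tendsto (fun c : ℝ => 2 * G * (‖x‖ ^ (-m) + c * ‖x‖ ^ (-α))) (𝓝[>] 0)
      (𝓝 (2 * G * (‖x‖ ^ (-m) + 0 * ‖x‖ ^ (-α)))) := by
    refine Filter.Tendsto.mono_left ?_ nhdsWithin_le_nhds
    exact Continuous.tendsto (by fun_prop) 0
  rw [zero_mul, add_zero] at h1
  exact ge_of_tendsto h1 (eventually_mem_nhdsWithin.mono fun c hc => hlim c hc x hx)

lemma two_mul_rpow_le {N : ℕ} (hN : 3 ≤ N) {t : ℝ} (ht : |t| ≤ 1) {x y : Euc N}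
    (h1 : Real.exp (t / 2) • x ≠ Real.exp (-t / 2) • y)
    (h2 : Real.exp (-t / 2) • x ≠ Real.exp (t / 2) • y) :
    2 * ‖x - y‖ ^ (2 - (N : ℝ)) ≤ ‖Real.exp (t / 2) • x - Real.exp (-t / 2) • y‖ ^ (2 - (N : ℝ)) +
      ‖Real.exp (-t / 2) • x - Real.exp (t / 2) • y‖ ^ (2 - (N : ℝ)) +
      N * |t| ^ (3 / 2 : ℝ) *
        (‖x - y‖ ^ (1 / 2 - (N : ℝ)) * (‖x‖ ^ (3 / 2 : ℝ) + ‖y‖ ^ (3 / 2 : ℝ))) := by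
  have hN3 : (3 : ℝ) ≤ N := by exact_mod_cast hN
  set P := ‖Real.exp (t / 2) • x - Real.exp (-t / 2) • y‖ with hP
  set Q := ‖Real.exp (-t / 2) • x - Real.exp (t / 2) • y‖ with hQ
  have hP0 : 0 < P := norm_pos_iff.2 (sub_ne_zero.2 h1)
  have hQ0 : 0 < Q := norm_pos_iff.2 (sub_ne_zero.2 h2)
  rcases eq_or_ne x y with hxy | hxy
  · rw [hxy, sub_self, norm_zero, Real.zero_rpow (by linarith), mul_zero]
    positivity
  set d := ‖x - y‖ with hd
  have hd0 : 0 < d := norm_pos_iff.2 (sub_ne_zero.2 hxy)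
  set s : ℝ := ((N : ℝ) - 2) / 2 with hs
  have hs0 : 0 < s := by
    rw [hs]
    linarith
  set w : ℝ := ‖x‖ ^ (3 / 2 : ℝ) + ‖y‖ ^ (3 / 2 : ℝ) with hw
  set η : ℝ := (Real.cosh t - 1) * (‖x‖ ^ 2 + ‖y‖ ^ 2) with hη
  have hη0 : 0 ≤ η := mul_nonneg (by linarith [Real.one_le_cosh t]) (by positivity)
  have hPQ : P ^ 2 + Q ^ 2 = 2 * (d ^ 2 + η) := by
    have e1 : Real.exp (t / 2) ^ 2 = Real.exp t := by
      rw [← Real.exp_nat_mul]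
      congr 1
      push_cast
      ring
    have e2 : Real.exp (-t / 2) ^ 2 = Real.exp (-t) := by
      rw [← Real.exp_nat_mul]
      congr 1
      push_cast
      ring
    have e3 : Real.exp (t / 2) * Real.exp (-t / 2) = 1 := by
      rw [← Real.exp_add, ← Real.exp_zero]
      congr 1
      ring
    rw [hP, hQ, hd, hη, norm_sub_sq_real, norm_sub_sq_real, norm_sub_sq_real]
    simp only [norm_smul, real_inner_smul_left, real_inner_smul_right, Real.norm_eq_abs,
      Real.abs_exp, mul_pow, e1, e2]
    rw [Real.cosh_eq]
    linear_combination (-4 * inner ℝ x y) * e3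
  have hηt : η ^ (3 / 4 : ℝ) ≤ |t| ^ (3 / 2 : ℝ) * w := by
    have hc : Real.cosh t - 1 ≤ |t| ^ 2 := by
      have a1 := Real.cosh_le_exp_half_sq t
      have ht2 : t ^ 2 ≤ 1 := by
        rw [← sq_abs]
        nlinarith [abs_nonneg t]
      have a2 := Real.abs_exp_sub_one_le (x := t ^ 2 / 2) (by
        rw [abs_of_nonneg (by positivity)]
        linarith)
      rw [abs_of_nonneg (by positivity : 0 ≤ t ^ 2 / 2)] at a2
      have a3 := (abs_le.1 a2).2
      rw [sq_abs]
      linarith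
    calc η ^ (3 / 4 : ℝ) ≤ (|t| ^ 2 * (‖x‖ ^ 2 + ‖y‖ ^ 2)) ^ (3 / 4 : ℝ) := by
          refine Real.rpow_le_rpow hη0 ?_ (by norm_num)
          rw [hη]
          gcongr
      _ ≤ |t| ^ (3 / 2 : ℝ) * ((‖x‖ ^ 2) ^ (3 / 4 : ℝ) + (‖y‖ ^ 2) ^ (3 / 4 : ℝ)) := by
          rw [Real.mul_rpow (by positivity) (by positivity), ← Real.rpow_natCast |t| 2,
            ← Real.rpow_mul (abs_nonneg t),
            show ((2 : ℕ) : ℝ) * (3 / 4) = 3 / 2 by norm_num]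
          gcongr
          exact Real.rpow_add_le_add_rpow (by positivity) (by positivity) (by norm_num)
            (by norm_num)
      _ = _ := by
          rw [← Real.rpow_natCast ‖x‖ 2, ← Real.rpow_natCast ‖y‖ 2,
            ← Real.rpow_mul (norm_nonneg x), ← Real.rpow_mul (norm_nonneg y),
            show ((2 : ℕ) : ℝ) * (3 / 4) = 3 / 2 by norm_num]
  have hamgm : 2 * (d ^ 2 + η) ^ (-s) ≤ P ^ (2 - (N : ℝ)) + Q ^ (2 - (N : ℝ)) := by
    have b1 : P * Q ≤ d ^ 2 + η := by nlinarith [sq_nonneg (P - Q)]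
    have b2 : (d ^ 2 + η) ^ (-s) ≤ P ^ (-s) * Q ^ (-s) := by
      rw [← Real.mul_rpow hP0.le hQ0.le]
      exact Real.rpow_le_rpow_of_nonpos (by positivity) b1 (by linarith)
    have b3 : ∀ z : ℝ, 0 < z → z ^ (2 - (N : ℝ)) = z ^ (-s) * z ^ (-s) := by
      intro z hz
      rw [← Real.rpow_add hz]
      congr 1
      rw [hs]
      ring
    rw [b3 P hP0, b3 Q hQ0]
    nlinarith [sq_nonneg (P ^ (-s) - Q ^ (-s))]
  set z : ℝ := η / d ^ 2 with hz
  have hz0 : 0 ≤ z := by positivity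
  have hz34 : z ^ (3 / 4 : ℝ) = η ^ (3 / 4 : ℝ) * d ^ (-(3 / 2) : ℝ) := by
    rw [hz, Real.div_rpow hη0 (by positivity), Real.rpow_neg hd0.le, ← Real.rpow_natCast d 2,
      ← Real.rpow_mul hd0.le, show ((2 : ℕ) : ℝ) * (3 / 4) = 3 / 2 by norm_num, div_eq_mul_inv]
  have hbern : 1 - (s + 1) * z ^ (3 / 4 : ℝ) ≤ (1 + z) ^ (-s) := by
    rcases le_or_gt 1 z with h | h
    · have c1 : 1 ≤ z ^ (3 / 4 : ℝ) := Real.one_le_rpow h (by norm_num)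
      have c2 : 0 ≤ (1 + z) ^ (-s) := by positivity
      nlinarith
    · have c1 : z ≤ z ^ (3 / 4 : ℝ) := Real.self_le_rpow_of_le_one hz0 h.le (by norm_num)
      have c2 : Real.log (1 + z) ≤ z := by
        have := Real.log_le_sub_one_of_pos (by linarith : 0 < 1 + z)
        linarith
      rw [Real.rpow_def_of_pos (show 0 < 1 + z by linarith)]
      have c3 := Real.add_one_le_exp (Real.log (1 + z) * -s)
      nlinarith
  have hdz : (d ^ 2 + η) ^ (-s) = d ^ (2 - (N : ℝ)) * (1 + z) ^ (-s) := by
    rw [show d ^ 2 + η = d ^ 2 * (1 + z) by rw [hz]; field_simp,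
      Real.mul_rpow (by positivity) (by positivity), ← Real.rpow_natCast d 2,
      ← Real.rpow_mul hd0.le]
    congr 2
    rw [hs]
    push_cast
    ring
  have hdd : d ^ (2 - (N : ℝ)) * d ^ (-(3 / 2) : ℝ) = d ^ (1 / 2 - (N : ℝ)) := by
    rw [← Real.rpow_add hd0]
    congr 1
    ring
  have hsN : 2 * (s + 1) = N := by
    rw [hs]
    ring
  calc 2 * d ^ (2 - (N : ℝ))
      = 2 * (d ^ (2 - (N : ℝ)) * (1 - (s + 1) * z ^ (3 / 4 : ℝ))) +
        N * η ^ (3 / 4 : ℝ) * d ^ (1 / 2 - (N : ℝ)) := by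
        linear_combination (2 * d ^ (2 - (N : ℝ)) * (s + 1)) * hz34 +
          (2 * (s + 1) * η ^ (3 / 4 : ℝ)) * hdd +
          (η ^ (3 / 4 : ℝ) * d ^ (1 / 2 - (N : ℝ))) * hsN
    _ ≤ 2 * (d ^ 2 + η) ^ (-s) + N * (|t| ^ (3 / 2 : ℝ) * w) * d ^ (1 / 2 - (N : ℝ)) := by
        rw [hdz]
        gcongr
    _ ≤ P ^ (2 - (N : ℝ)) + Q ^ (2 - (N : ℝ)) +
        N * (|t| ^ (3 / 2 : ℝ) * w) * d ^ (1 / 2 - (N : ℝ)) := by gcongr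
    _ = _ := by ring

/-- The mutual Newtonian energy of the densities `f` and `g`, dilated in opposite directions. -/
def mutualEnergy {N : ℕ} (f g : Euc N → ℝ) (t : ℝ) : ℝ≥0∞ :=
  ∫⁻ x, ∫⁻ y, ENNReal.ofReal
    (‖Real.exp (t / 2) • x - Real.exp (-t / 2) • y‖ ^ (2 - (N : ℝ)) * f y * g x)

lemma mutualEnergy_swap {N : ℕ} {f g : Euc N → ℝ} (hf : Measurable f) (hg : Measurable g) (t : ℝ) :
    mutualEnergy f g t = mutualEnergy g f (-t) := by
  rw [mutualEnergy, mutualEnergy, lintegral_lintegral_swap]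
  · refine lintegral_congr fun y => lintegral_congr fun x => ?_
    rw [norm_sub_rev, neg_neg]
    congr 1
    ring
  · refine Measurable.aemeasurable (Measurable.ennreal_ofReal ?_)
    refine ((Measurable.pow_const ?_ _).mul (hf.comp measurable_snd)).mul (hg.comp measurable_fst)
    have hc : Continuous fun z : Euc N × Euc N =>
        ‖Real.exp (t / 2) • z.1 - Real.exp (-t / 2) • z.2‖ := by fun_prop
    exact hc.measurable

lemma mutualEnergy_eq {N : ℕ} {κ : ℝ} {w f g : Euc N → ℝ} (hκ : 0 < κ)
    (hw : ∀ x, 0 < w x) (hg : ∀ x, 0 ≤ g x)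
    (hrep : ∀ x, ENNReal.ofReal (κ * w x) = newton f x) (t : ℝ) :
    mutualEnergy f g t = ENNReal.ofReal (κ * Real.exp (((N : ℝ) - 2) / 2 * t)) *
      ∫⁻ x, ENNReal.ofReal (w (Real.exp t • x) * g x) := by
  rw [mutualEnergy, ← lintegral_const_mul' _ _ ENNReal.ofReal_ne_top]
  refine lintegral_congr fun x => ?_
  have hwx := hw (Real.exp t • x)
  have hgx := hg x
  have h1 : ∀ y : Euc N, ENNReal.ofReal
      (‖Real.exp (t / 2) • x - Real.exp (-t / 2) • y‖ ^ (2 - (N : ℝ)) * f y * g x) =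
      ENNReal.ofReal (Real.exp (((N : ℝ) - 2) / 2 * t) * g x) *
        ENNReal.ofReal (‖Real.exp t • x - y‖ ^ (2 - (N : ℝ)) * f y) := by
    intro y
    rw [← ENNReal.ofReal_mul (by positivity)]
    have e1 : Real.exp (t / 2) • x - Real.exp (-t / 2) • y =
        Real.exp (-t / 2) • (Real.exp t • x - y) := by
      rw [smul_sub, smul_smul, ← Real.exp_add]
      congr 3
      ring
    rw [e1, norm_smul, Real.norm_eq_abs, Real.abs_exp,
      Real.mul_rpow (by positivity) (by positivity), ← Real.exp_mul,
      show -t / 2 * (2 - (N : ℝ)) = ((N : ℝ) - 2) / 2 * t by ring]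
    congr 1
    ring
  simp_rw [h1]
  rw [lintegral_const_mul' _ _ ENNReal.ofReal_ne_top, ← newton, ← hrep,
    ← ENNReal.ofReal_mul (by positivity), ← ENNReal.ofReal_mul (by positivity)]
  congr 1
  ring

lemma mutualEnergy_le {N : ℕ} {κ b q : ℝ} {w f : Euc N → ℝ} (hκ : 0 < κ) (hq : 0 < q)
    (hw : ∀ x, 0 < w x) (hwc : Continuous w)
    (hrep : ∀ x, ENNReal.ofReal (κ * w x) = newton f x) (t : ℝ) :
    mutualEnergy f (fun x => ‖x‖ ^ b * w x ^ q) t ≤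
      ENNReal.ofReal (Real.exp ((((N : ℝ) - 2) / 2 - (N + b) / (q + 1)) * t)) *
        mutualEnergy f (fun x => ‖x‖ ^ b * w x ^ q) 0 := by
  have hg : ∀ x, 0 ≤ ‖x‖ ^ b * w x ^ q := fun x => by
    have := hw x
    positivity
  rw [mutualEnergy_eq hκ hw hg hrep, mutualEnergy_eq hκ hw hg hrep]
  set μ : ℝ := (N + b) / (q + 1) with hμ
  set F : Euc N → ℝ≥0∞ := fun x => ENNReal.ofReal (‖x‖ ^ b * w x ^ (q + 1)) with hF
  have hFm : Measurable F := measurable_weight hwc |>.ennreal_ofReal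
  have h0 : ∫⁻ x, ENNReal.ofReal (w (Real.exp 0 • x) * (‖x‖ ^ b * w x ^ q)) = ∫⁻ x, F x := by
    refine lintegral_congr fun x => ?_
    rw [Real.exp_zero, one_smul, hF]
    congr 1
    rw [Real.rpow_add_one (hw x).ne']
    ring
  have hyoung : ∀ x, ENNReal.ofReal (w (Real.exp t • x) * (‖x‖ ^ b * w x ^ q)) ≤
      ENNReal.ofReal (Real.exp (-(μ * t)) * (q / (q + 1))) * F x +
      ENNReal.ofReal (Real.exp (-(μ * t)) * (Real.exp (N * t) / (q + 1))) *
        F (Real.exp t • x) := by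
    intro x
    have hwx := hw x
    have hwt := hw (Real.exp t • x)
    rw [hF, ← ENNReal.ofReal_mul (by positivity), ← ENNReal.ofReal_mul (by positivity),
      ← ENNReal.ofReal_add (by positivity) (by positivity)]
    refine ENNReal.ofReal_le_ofReal ?_
    have hY := Real.geom_mean_le_arith_mean2_weighted (w₁ := q / (q + 1)) (w₂ := 1 / (q + 1))
      (p₁ := w x ^ (q + 1)) (p₂ := Real.exp ((N + b) * t) * w (Real.exp t • x) ^ (q + 1))
      (by positivity) (by positivity) (by positivity) (by positivity) (by field_simp)
    rw [Real.mul_rpow (by positivity) (by positivity), ← Real.rpow_mul hwx.le,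
      ← Real.rpow_mul hwt.le, ← Real.exp_mul,
      show (q + 1) * (q / (q + 1)) = q by field_simp,
      show (q + 1) * (1 / (q + 1)) = 1 by field_simp, Real.rpow_one,
      show (N + b) * t * (1 / (q + 1)) = μ * t by rw [hμ]; ring] at hY
    have e1 : ‖Real.exp t • x‖ ^ b = Real.exp (b * t) * ‖x‖ ^ b := by
      rw [norm_smul, Real.norm_eq_abs, Real.abs_exp,
        Real.mul_rpow (by positivity) (by positivity), ← Real.exp_mul, mul_comm t]
    have e2 : Real.exp ((N + b) * t) = Real.exp (N * t) * Real.exp (b * t) := by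
      rw [← Real.exp_add]
      congr 1
      ring
    have e3 : Real.exp (-(μ * t)) * Real.exp (μ * t) = 1 := by
      rw [← Real.exp_add, neg_add_cancel, Real.exp_zero]
    rw [e2] at hY
    calc w (Real.exp t • x) * (‖x‖ ^ b * w x ^ q)
        = Real.exp (-(μ * t)) * ‖x‖ ^ b *
          (w x ^ q * (Real.exp (μ * t) * w (Real.exp t • x))) := by
          linear_combination (-(w (Real.exp t • x) * (‖x‖ ^ b * w x ^ q))) * e3
      _ ≤ Real.exp (-(μ * t)) * ‖x‖ ^ b * (q / (q + 1) * w x ^ (q + 1) + 1 / (q + 1) *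
          (Real.exp (N * t) * Real.exp (b * t) * w (Real.exp t • x) ^ (q + 1))) :=
          mul_le_mul_of_nonneg_left hY (by positivity)
      _ = _ := by
          rw [e1]
          ring
  have hscale : ∫⁻ x, F (Real.exp t • x) = ENNReal.ofReal (Real.exp (-(N * t))) * ∫⁻ x, F x := by
    rw [lintegral_euc_smul F (Real.exp_pos t), ← Real.exp_mul]
    congr 3
    ring
  have hint : ∫⁻ x, ENNReal.ofReal (w (Real.exp t • x) * (‖x‖ ^ b * w x ^ q)) ≤
      ENNReal.ofReal (Real.exp (-(μ * t))) * ∫⁻ x, F x := by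
    refine (lintegral_mono hyoung).trans_eq ?_
    rw [lintegral_add_left (hFm.const_mul _), lintegral_const_mul' _ _ ENNReal.ofReal_ne_top,
      lintegral_const_mul' _ _ ENNReal.ofReal_ne_top, hscale, ← mul_assoc, ← add_mul,
      ← ENNReal.ofReal_mul (by positivity), ← ENNReal.ofReal_add (by positivity) (by positivity)]
    congr 2
    have e4 : Real.exp (N * t) * Real.exp (-(N * t)) = 1 := by
      rw [← Real.exp_add, add_neg_cancel, Real.exp_zero]
    have e5 : q / (q + 1) + 1 / (q + 1) = 1 := by field_simp
    linear_combination (Real.exp (-(μ * t)) / (q + 1)) * e4 + Real.exp (-(μ * t)) * e5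
  rw [h0]
  refine (mul_le_mul_right hint _).trans_eq ?_
  rw [← mul_assoc, ← mul_assoc, ← ENNReal.ofReal_mul (by positivity),
    ← ENNReal.ofReal_mul (by positivity)]
  congr 2
  rw [mul_zero, Real.exp_zero, mul_one, mul_assoc, ← Real.exp_add, mul_comm]
  congr 2
  ring

lemma lintegral_riesz_lt_top {N : ℕ} (hN : 3 ≤ N) {A A' Cf Cg : ℝ} {f g : Euc N → ℝ}
    (hCf : 0 ≤ Cf) (hCg : 0 ≤ Cg) (hg0 : ∀ x, 0 ≤ g x)
    (hf : ∀ y, y ≠ 0 → f y ≤ Cf * ‖y‖ ^ (-A)) (hg : ∀ x, x ≠ 0 → g x ≤ Cg * ‖x‖ ^ (-A'))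
    (hg2 : ∀ x, x ≠ 0 → ‖x‖ ≤ 1 → g x ≤ Cg * ‖x‖ ^ (-2 : ℝ))
    (hA : 1 / 2 < A) (hAN : A < N) (hAA : (N : ℝ) + 2 < A + A') :
    ∫⁻ x, ∫⁻ y, ENNReal.ofReal (‖x - y‖ ^ (1 / 2 - (N : ℝ)) * ‖x‖ ^ (3 / 2 : ℝ) * f y * g x) < ⊤ := by
  obtain ⟨C, hC, hr⟩ := exists_riesz_le hN (σ := 1 / 2) (by norm_num) hA hAN
  obtain ⟨C₁, hC₁, h1⟩ := exists_lintegral_ball_rpow_le hN hAN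
  obtain ⟨C₂, hC₂, h2⟩ := exists_lintegral_compl_ball_rpow_le hN (s := A + A' - 2) (by linarith)
  have hinner : ∀ x : Euc N, x ≠ 0 →
      ∫⁻ y, ENNReal.ofReal (‖x - y‖ ^ (1 / 2 - (N : ℝ)) * ‖x‖ ^ (3 / 2 : ℝ) * f y * g x) ≤
        ENNReal.ofReal (Cf * C * (‖x‖ ^ (2 - A) * g x)) := by
    intro x hx
    have hgx := hg0 x
    have hx0 : 0 < ‖x‖ := norm_pos_iff.2 hx
    calc _ ≤ ∫⁻ y, ENNReal.ofReal (‖x‖ ^ (3 / 2 : ℝ) * g x * Cf) *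
          ENNReal.ofReal (‖x - y‖ ^ (1 / 2 - (N : ℝ)) * ‖y‖ ^ (-A)) := by
          refine lintegral_mono_ae ?_
          filter_upwards [ae_euc_ne hN 0] with y hy
          rw [← ENNReal.ofReal_mul (by positivity)]
          refine ENNReal.ofReal_le_ofReal ?_
          calc _ ≤ ‖x - y‖ ^ (1 / 2 - (N : ℝ)) * ‖x‖ ^ (3 / 2 : ℝ) * (Cf * ‖y‖ ^ (-A)) * g x := by
                gcongr
                exact hf y hy
            _ = _ := by ring
      _ ≤ ENNReal.ofReal (‖x‖ ^ (3 / 2 : ℝ) * g x * Cf) *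
          ENNReal.ofReal (C * ‖x‖ ^ (1 / 2 - A)) := by
          rw [lintegral_const_mul' _ _ ENNReal.ofReal_ne_top]
          gcongr
          exact hr x hx
      _ = _ := by
          rw [← ENNReal.ofReal_mul (by positivity),
            show (2 : ℝ) - A = 3 / 2 + (1 / 2 - A) by ring, Real.rpow_add hx0]
          congr 1
          ring
  refine (lintegral_mono_ae ((ae_euc_ne hN 0).mono hinner)).trans_lt ?_
  rw [← lintegral_add_compl _ (measurableSet_ball (x := (0 : Euc N)) (ε := 1))]
  refine ENNReal.add_lt_top.2 ⟨?_, ?_⟩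
  · calc _ ≤ ∫⁻ x in ball (0 : Euc N) 1, ENNReal.ofReal (Cf * C * Cg) *
          ENNReal.ofReal (‖x‖ ^ (-A)) := by
          refine lintegral_mono_ae ?_
          filter_upwards [ae_restrict_of_ae (ae_euc_ne hN 0),
            ae_restrict_mem measurableSet_ball] with x hx hxb
          have hx0 : 0 < ‖x‖ := norm_pos_iff.2 hx
          rw [← ENNReal.ofReal_mul (by positivity), mul_assoc (Cf * C)]
          refine ENNReal.ofReal_le_ofReal (mul_le_mul_of_nonneg_left ?_ (by positivity))
          calc _ ≤ ‖x‖ ^ (2 - A) * (Cg * ‖x‖ ^ (-2 : ℝ)) := by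
                gcongr
                exact hg2 x hx (mem_ball_zero_iff.1 hxb).le
            _ = _ := by
                rw [show -A = (2 - A) + -2 by ring, Real.rpow_add hx0]
                ring
      _ < ⊤ := by
          rw [lintegral_const_mul' _ _ ENNReal.ofReal_ne_top]
          exact ENNReal.mul_lt_top ENNReal.ofReal_lt_top
            ((h1 1 one_pos).trans_lt ENNReal.ofReal_lt_top)
  · calc _ ≤ ∫⁻ x in (ball (0 : Euc N) 1)ᶜ, ENNReal.ofReal (Cf * C * Cg) *
          ENNReal.ofReal (‖x‖ ^ (-(A + A' - 2))) := by
          refine lintegral_mono_ae (ae_restrict_of_ae ?_)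
          filter_upwards [ae_euc_ne hN 0] with x hx
          have hx0 : 0 < ‖x‖ := norm_pos_iff.2 hx
          rw [← ENNReal.ofReal_mul (by positivity), mul_assoc (Cf * C)]
          refine ENNReal.ofReal_le_ofReal (mul_le_mul_of_nonneg_left ?_ (by positivity))
          calc _ ≤ ‖x‖ ^ (2 - A) * (Cg * ‖x‖ ^ (-A')) := by
                gcongr
                exact hg x hx
            _ = _ := by
                rw [show -(A + A' - 2) = (2 - A) + -A' by ring, Real.rpow_add hx0]
                ring
      _ < ⊤ := by
          rw [lintegral_const_mul' _ _ ENNReal.ofReal_ne_top]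
          exact ENNReal.mul_lt_top ENNReal.ofReal_lt_top
            ((h2 1 one_pos).trans_lt ENNReal.ofReal_lt_top)

/-- The remainder in the second-order symmetric difference of the mutual energy. -/
def energyRemainder {N : ℕ} (f g : Euc N → ℝ) : ℝ≥0∞ :=
  ∫⁻ x, ∫⁻ y, ENNReal.ofReal (‖x - y‖ ^ (1 / 2 - (N : ℝ)) *
    (‖x‖ ^ (3 / 2 : ℝ) + ‖y‖ ^ (3 / 2 : ℝ)) * f y * g x)

lemma energyRemainder_lt_top {N : ℕ} (hN : 3 ≤ N) {A A' Cf Cg : ℝ} {f g : Euc N → ℝ}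
    (hfm : Measurable f) (hgm : Measurable g)
    (hCf : 0 ≤ Cf) (hCg : 0 ≤ Cg) (hf0 : ∀ x, 0 ≤ f x) (hg0 : ∀ x, 0 ≤ g x)
    (hf : ∀ y, y ≠ 0 → f y ≤ Cf * ‖y‖ ^ (-A)) (hg : ∀ x, x ≠ 0 → g x ≤ Cg * ‖x‖ ^ (-A'))
    (hf2 : ∀ x, x ≠ 0 → ‖x‖ ≤ 1 → f x ≤ Cf * ‖x‖ ^ (-2 : ℝ))
    (hg2 : ∀ x, x ≠ 0 → ‖x‖ ≤ 1 → g x ≤ Cg * ‖x‖ ^ (-2 : ℝ))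
    (hA : 1 / 2 < A) (hAN : A < N) (hA' : 1 / 2 < A') (hAN' : A' < N)
    (hAA : (N : ℝ) + 2 < A + A') : energyRemainder f g < ⊤ := by
  have h1 := lintegral_riesz_lt_top hN hCf hCg hg0 hf hg hg2 hA hAN hAA
  have h2 := lintegral_riesz_lt_top hN hCg hCf hf0 hg hf hf2 hA' hAN' (by linarith)
  have hd : Measurable fun z : Euc N × Euc N => ‖z.1 - z.2‖ := by
    have hc : Continuous fun z : Euc N × Euc N => ‖z.1 - z.2‖ := by fun_prop
    exact hc.measurable
  have hm : Measurable (Function.uncurry fun x y : Euc N =>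
      ENNReal.ofReal (‖x - y‖ ^ (1 / 2 - (N : ℝ)) * ‖x‖ ^ (3 / 2 : ℝ) * f y * g x)) :=
    ((((hd.pow_const _).mul (measurable_fst.norm.pow_const _)).mul
      (hfm.comp measurable_snd)).mul (hgm.comp measurable_fst)).ennreal_ofReal
  have hm' : Measurable (Function.uncurry fun x y : Euc N =>
      ENNReal.ofReal (‖x - y‖ ^ (1 / 2 - (N : ℝ)) * ‖x‖ ^ (3 / 2 : ℝ) * g y * f x)) :=
    ((((hd.pow_const _).mul (measurable_fst.norm.pow_const _)).mul
      (hgm.comp measurable_snd)).mul (hfm.comp measurable_fst)).ennreal_ofReal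
  rw [lintegral_lintegral_swap hm'.aemeasurable] at h2
  refine lt_of_eq_of_lt ?_ (ENNReal.add_lt_top.2 ⟨h1, h2⟩)
  rw [energyRemainder, ← lintegral_add_left hm.lintegral_prod_right]
  refine lintegral_congr fun x => ?_
  have hmx : Measurable fun y : Euc N =>
      ENNReal.ofReal (‖x - y‖ ^ (1 / 2 - (N : ℝ)) * ‖x‖ ^ (3 / 2 : ℝ) * f y * g x) :=
    hm.of_uncurry_left
  rw [← lintegral_add_left hmx]
  refine lintegral_congr fun y => ?_
  have hfy := hf0 y
  have hgx := hg0 x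
  rw [← ENNReal.ofReal_add (by positivity) (by positivity), norm_sub_rev y x]
  congr 1
  ring

lemma two_mul_mutualEnergy_le {N : ℕ} (hN : 3 ≤ N) {f g : Euc N → ℝ}
    (hfm : Measurable f) (hgm : Measurable g) (hf0 : ∀ x, 0 ≤ f x) (hg0 : ∀ x, 0 ≤ g x)
    {t : ℝ} (ht : |t| ≤ 1) :
    ENNReal.ofReal 2 * mutualEnergy f g 0 ≤ mutualEnergy f g t + mutualEnergy f g (-t) +
      ENNReal.ofReal (N * |t| ^ (3 / 2 : ℝ)) * energyRemainder f g := by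
  have hm : ∀ s : ℝ, Measurable (Function.uncurry fun x y : Euc N => ENNReal.ofReal
      (‖Real.exp (s / 2) • x - Real.exp (-s / 2) • y‖ ^ (2 - (N : ℝ)) * f y * g x)) := by
    intro s
    have hc : Continuous fun z : Euc N × Euc N =>
        ‖Real.exp (s / 2) • z.1 - Real.exp (-s / 2) • z.2‖ := by fun_prop
    exact (((hc.measurable.pow_const _).mul (hfm.comp measurable_snd)).mul
      (hgm.comp measurable_fst)).ennreal_ofReal
  have hms : ∀ (s : ℝ) (x : Euc N), Measurable fun y : Euc N => ENNReal.ofReal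
      (‖Real.exp (s / 2) • x - Real.exp (-s / 2) • y‖ ^ (2 - (N : ℝ)) * f y * g x) :=
    fun s x => (hm s).of_uncurry_left
  rw [mutualEnergy, mutualEnergy, mutualEnergy, energyRemainder,
    ← lintegral_const_mul' _ _ ENNReal.ofReal_ne_top, ← lintegral_const_mul' _ _ ENNReal.ofReal_ne_top,
    ← lintegral_add_left (hm t).lintegral_prod_right,
    ← lintegral_add_left ((hm t).lintegral_prod_right.fun_add (hm (-t)).lintegral_prod_right)]
  refine lintegral_mono fun x => ?_
  rw [← lintegral_const_mul' _ _ ENNReal.ofReal_ne_top, ← lintegral_const_mul' _ _ ENNReal.ofReal_ne_top,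
    ← lintegral_add_left (hms t x), ← lintegral_add_left ((hms t x).fun_add (hms (-t) x))]
  refine lintegral_mono_ae ?_
  filter_upwards [ae_euc_ne hN (Real.exp t • x), ae_euc_ne hN (Real.exp (-t) • x)] with y h1 h2
  have hfy := hf0 y
  have hgx := hg0 x
  have hne : ∀ s : ℝ, y ≠ Real.exp s • x → Real.exp (s / 2) • x ≠ Real.exp (-s / 2) • y := by
    intro s hs he
    apply hs
    have h3 := congrArg (fun z => Real.exp (s / 2) • z) he
    simp only [smul_smul, ← Real.exp_add] at h3
    rw [show s / 2 + s / 2 = s by ring, show s / 2 + -s / 2 = 0 by ring, Real.exp_zero,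
      one_smul] at h3
    exact h3.symm
  have h3 := hne (-t) h2
  rw [neg_neg] at h3
  have key := two_mul_rpow_le hN ht (hne t h1) h3
  rw [← ENNReal.ofReal_mul (by norm_num),
    ← ENNReal.ofReal_mul (by positivity), ← ENNReal.ofReal_add (by positivity) (by positivity),
    ← ENNReal.ofReal_add (by positivity) (by positivity)]
  refine ENNReal.ofReal_le_ofReal ?_
  have key2 := mul_le_mul_of_nonneg_right key (mul_nonneg hfy hgx)
  simp only [neg_neg, zero_div, neg_zero, Real.exp_zero, one_smul]
  refine le_trans (le_of_eq ?_) (key2.trans_eq ?_) <;> ring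

lemma mutualEnergy_zero_lt_top {N : ℕ} {f g : Euc N → ℝ} (hN : 3 ≤ N)
    (hf0 : ∀ x, 0 ≤ f x) (hg0 : ∀ x, 0 ≤ g x) (hQ : energyRemainder f g < ⊤) :
    mutualEnergy f g 0 < ⊤ := by
  refine lt_of_le_of_lt (b := ENNReal.ofReal (2 ^ (3 / 2 : ℝ)) * energyRemainder f g) ?_
    (ENNReal.mul_lt_top ENNReal.ofReal_lt_top hQ)
  rw [mutualEnergy, energyRemainder, ← lintegral_const_mul' _ _ ENNReal.ofReal_ne_top]
  refine lintegral_mono fun x => ?_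
  rw [← lintegral_const_mul' _ _ ENNReal.ofReal_ne_top]
  refine lintegral_mono_ae ?_
  filter_upwards [ae_euc_ne hN x] with y hy
  have hfy := hf0 y
  have hgx := hg0 x
  have hd : 0 < ‖x - y‖ := norm_pos_iff.2 (sub_ne_zero.2 hy.symm)
  rw [← ENNReal.ofReal_mul (by positivity)]
  refine ENNReal.ofReal_le_ofReal ?_
  simp only [neg_zero, zero_div, Real.exp_zero, one_smul]
  calc _ = ‖x - y‖ ^ (1 / 2 - (N : ℝ)) * ‖x - y‖ ^ (3 / 2 : ℝ) * f y * g x := by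
        rw [← Real.rpow_add hd]
        congr 4
        ring
    _ ≤ ‖x - y‖ ^ (1 / 2 - (N : ℝ)) *
        (2 ^ (3 / 2 : ℝ) * (‖x‖ ^ (3 / 2 : ℝ) + ‖y‖ ^ (3 / 2 : ℝ))) * f y * g x := by
        gcongr
        exact (Real.rpow_le_rpow hd.le (norm_sub_le x y) (by norm_num)).trans
          (add_rpow_le_two_rpow_mul (norm_nonneg _) (norm_nonneg _) (by norm_num))
    _ = _ := by ring

/-- A mutual energy that is differentiable at second order cannot have a strict corner at `0`. -/
lemma false_of_mutualEnergy_le {N : ℕ} (hN : 3 ≤ N) {f g : Euc N → ℝ} {c₁ c₂ : ℝ}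
    (hfm : Measurable f) (hgm : Measurable g) (hf0 : ∀ x, 0 ≤ f x) (hg0 : ∀ x, 0 ≤ g x)
    (hQ : energyRemainder f g < ⊤) (hJ : mutualEnergy f g 0 ≠ 0) (hc : 0 < c₁ + c₂)
    (h1 : ∀ t, mutualEnergy f g t ≤ ENNReal.ofReal (Real.exp (c₁ * t)) * mutualEnergy f g 0)
    (h2 : ∀ t, mutualEnergy f g t ≤ ENNReal.ofReal (Real.exp (-(c₂ * t))) * mutualEnergy f g 0) :
    False := by
  have hJ' := mutualEnergy_zero_lt_top hN hf0 hg0 hQ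
  have hJ0 : 0 < (mutualEnergy f g 0).toReal := ENNReal.toReal_pos hJ hJ'.ne
  set J := (mutualEnergy f g 0).toReal with hJdef
  set Q := (energyRemainder f g).toReal with hQdef
  have hQ0 : 0 ≤ Q := ENNReal.toReal_nonneg
  have eJ : mutualEnergy f g 0 = ENNReal.ofReal J := (ENNReal.ofReal_toReal hJ'.ne).symm
  have eQ : energyRemainder f g = ENNReal.ofReal Q := (ENNReal.ofReal_toReal hQ.ne).symm
  have hreal : ∀ s : ℝ, 0 < s → s ≤ 1 → 2 * J ≤ Real.exp (-(c₂ * s ^ 2)) * J +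
      Real.exp (-(c₁ * s ^ 2)) * J + N * s ^ 3 * Q := by
    intro s hs hs1
    have hs2 : |s ^ 2| ≤ 1 := by
      rw [abs_of_nonneg (by positivity)]
      nlinarith
    have h := two_mul_mutualEnergy_le hN hfm hgm hf0 hg0 hs2
    have h' := h.trans (add_le_add_left (add_le_add (h2 (s ^ 2)) (h1 (-s ^ 2))) _)
    rw [eJ, eQ,
      ← ENNReal.ofReal_mul (by norm_num), ← ENNReal.ofReal_mul (by positivity),
      ← ENNReal.ofReal_mul (by positivity), ← ENNReal.ofReal_mul (by positivity),
      ← ENNReal.ofReal_add (by positivity) (by positivity),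
      ← ENNReal.ofReal_add (by positivity) (by positivity),
      ENNReal.ofReal_le_ofReal_iff (by positivity)] at h'
    rw [abs_of_nonneg (by positivity), ← Real.rpow_natCast s 2, ← Real.rpow_mul hs.le,
      show ((2 : ℕ) : ℝ) * (3 / 2) = (3 : ℕ) by norm_num, Real.rpow_natCast,
      Real.rpow_natCast, mul_neg] at h'
    exact h'
  set M := |c₁| + |c₂| + 1 with hM
  have hM0 : 0 < M := by positivity
  set T := (c₁ ^ 2 + c₂ ^ 2) * J + N * Q with hT
  have hT0 : 0 ≤ T := by positivity
  set s := min (1 / M) ((c₁ + c₂) * J / (2 * (T + 1))) with hs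
  have hs0 : 0 < s := by positivity
  have hsM : s ≤ 1 / M := min_le_left _ _
  have hsT : s ≤ (c₁ + c₂) * J / (2 * (T + 1)) := min_le_right _ _
  have hM1 : 1 ≤ M := by
    have := abs_nonneg c₁
    have := abs_nonneg c₂
    linarith
  rw [le_div_iff₀ hM0] at hsM
  rw [le_div_iff₀ (by positivity)] at hsT
  have hs1 : s ≤ 1 := by nlinarith
  have hexp : ∀ c : ℝ, |c| ≤ M → Real.exp (-(c * s ^ 2)) ≤ 1 - c * s ^ 2 + c ^ 2 * s ^ 3 := by
    intro c hcM
    have h3 : |-(c * s ^ 2)| ≤ 1 := by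
      rw [abs_neg, abs_mul, abs_of_nonneg (by positivity : 0 ≤ s ^ 2)]
      calc |c| * s ^ 2 ≤ M * s ^ 2 := by gcongr
        _ = s * M * s := by ring
        _ ≤ 1 * 1 := by gcongr
        _ = 1 := one_mul 1
    have h4 := (abs_le.1 (Real.abs_exp_sub_one_sub_id_le h3)).2
    have h5 : s ^ 4 ≤ s ^ 3 := pow_le_pow_of_le_one hs0.le hs1 (by norm_num)
    have h6 := mul_le_mul_of_nonneg_left h5 (sq_nonneg c)
    nlinarith
  have e1 := hexp c₁ (by linarith [abs_nonneg c₂])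
  have e2 := hexp c₂ (by linarith [abs_nonneg c₁])
  have e3 := hreal s hs0 hs1
  have e4 := mul_le_mul_of_nonneg_right e1 hJ0.le
  have e5 := mul_le_mul_of_nonneg_right e2 hJ0.le
  have e6 : s ^ 2 * ((c₁ + c₂) * J) ≤ s ^ 2 * (s * T) := by
    rw [hT]
    linarith
  have e7 := le_of_mul_le_mul_left e6 (by positivity)
  have e8 : 0 < (c₁ + c₂) * J := by positivity
  linarith

lemma exists_decay_of_newton {N : ℕ} (hN : 3 ≤ N) {κ c τ : ℝ} {w h : Euc N → ℝ} (hκ : 0 < κ)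
    (hw : ∀ x, 0 < w x) (hrep : ∀ x, ENNReal.ofReal (κ * w x) = newton h x)
    (hτ : 0 < τ) (hτN : τ < (N : ℝ) - 2) (hc : 0 ≤ c)
    (hh : ∀ y, y ≠ 0 → h y ≤ c * ‖y‖ ^ (-(τ + 2))) :
    ∃ C : ℝ, 0 < C ∧ ∀ x, x ≠ 0 → w x ≤ C * ‖x‖ ^ (-τ) := by
  obtain ⟨C, hC, hn⟩ := exists_newton_le hN hτ hτN hτ hτN
  refine ⟨C * c / κ + 1, by positivity, fun x hx => ?_⟩
  have hwx := hw x
  have h1 := hn h c 0 hc le_rfl (fun y hy => by simpa using hh y hy) x hx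
  rw [← hrep, zero_mul, add_zero, ENNReal.ofReal_le_ofReal_iff (by positivity)] at h1
  have t0 : 0 ≤ ‖x‖ ^ (-τ) := by positivity
  calc w x ≤ C * (c * ‖x‖ ^ (-τ)) / κ := by
        rw [le_div_iff₀ hκ]
        linarith
    _ = C * c / κ * ‖x‖ ^ (-τ) := by ring
    _ ≤ _ := by
        gcongr
        linarith

lemma weight_le_of_decay {N : ℕ} {a p C σ τ : ℝ} {w : Euc N → ℝ} (hw : ∀ x, 0 < w x) (hp : 0 ≤ p)
    (hC : 0 ≤ C) (hdec : ∀ x, x ≠ 0 → w x ≤ C * ‖x‖ ^ (-σ)) (hτ : τ = p * σ - a) :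
    ∀ x, x ≠ 0 → ‖x‖ ^ a * w x ^ p ≤ C ^ p * ‖x‖ ^ (-τ) := by
  intro x hx
  have hx0 : 0 < ‖x‖ := norm_pos_iff.2 hx
  have hwx := hw x
  calc ‖x‖ ^ a * w x ^ p ≤ ‖x‖ ^ a * (C * ‖x‖ ^ (-σ)) ^ p := by
        gcongr
        exact hdec x hx
    _ = _ := by
        rw [Real.mul_rpow hC (by positivity), ← Real.rpow_mul hx0.le,
          show -τ = a + -σ * p by rw [hτ]; ring, Real.rpow_add hx0]
        ring

lemma weight_le_of_bound {N : ℕ} {a p B : ℝ} {w : Euc N → ℝ} (hw : ∀ x, 0 < w x) (hp : 0 ≤ p)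
    (ha : -2 < a) (hB : ∀ x, w x ≤ B) :
    ∀ x, x ≠ 0 → ‖x‖ ≤ 1 → ‖x‖ ^ a * w x ^ p ≤ B ^ p * ‖x‖ ^ (-2 : ℝ) := by
  intro x hx hx1
  have hx0 : 0 < ‖x‖ := norm_pos_iff.2 hx
  have hwx := hw x
  rw [mul_comm]
  exact mul_le_mul (Real.rpow_le_rpow hwx.le (hB x) hp)
    (Real.rpow_le_rpow_of_exponent_ge hx0 hx1 ha.le) (by positivity)
    (Real.rpow_nonneg (hwx.le.trans (hB x)) _)

lemma exists_bound_of_continuous {N : ℕ} {w : Euc N → ℝ} (hw : Continuous w) {C R : ℝ}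
    (h : ∀ x, R ≤ ‖x‖ → w x ≤ C) : ∃ B : ℝ, ∀ x, w x ≤ B := by
  obtain ⟨B, hB⟩ := (isCompact_closedBall (0 : Euc N) R).bddAbove_image hw.continuousOn
  refine ⟨max B C, fun x => ?_⟩
  rcases le_total R ‖x‖ with hx | hx
  · exact (h x hx).trans (le_max_right _ _)
  · exact (hB (mem_image_of_mem w (mem_closedBall_zero_iff.2 hx))).trans (le_max_left _ _)

lemma mutualEnergy_zero_ne_zero {N : ℕ} (hN : 3 ≤ N) {κ : ℝ} {w f g : Euc N → ℝ} (hκ : 0 < κ)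
    (hw : ∀ x, 0 < w x) (hwc : Continuous w) (hg : ∀ x, 0 ≤ g x) (hgm : Measurable g)
    (hgpos : ∀ x, x ≠ 0 → 0 < g x)
    (hrep : ∀ x, ENNReal.ofReal (κ * w x) = newton f x) : mutualEnergy f g 0 ≠ 0 := by
  rw [mutualEnergy_eq hκ hw hg hrep]
  refine mul_ne_zero (ENNReal.ofReal_pos.2 (by positivity)).ne' fun h => ?_
  simp only [Real.exp_zero, one_smul] at h
  rw [lintegral_eq_zero_iff (hwc.measurable.fun_mul hgm).ennreal_ofReal] at h
  have : Nonempty (Fin N) := ⟨⟨0, by omega⟩⟩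
  obtain ⟨x, hx, hx0⟩ := (h.and (ae_euc_ne hN 0)).exists
  exact (ENNReal.ofReal_pos.2 (mul_pos (hw x) (hgpos x hx0))).ne' hx

/-- Theorem 1.10 (i): in the supercritical case with `0 ≤ a - b ≤ (N-2)(p-q)`, the
Hénon–Lane–Emden system admits no positive solution with `u ∈ L^{N/α̃}` and
`u = O(|x|^{-α̃})` at infinity. -/
theorem stmt_8 (N : ℕ) (hN : 3 ≤ N) (p q a b : ℝ)
    (hq : 0 < q) (hqp : q ≤ p) (hpq : 1 < p * q)
    (ha : -2 < a) (hb : -2 < b)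
    (hsup : ((N : ℝ) + a) / (p + 1) + ((N : ℝ) + b) / (q + 1) < (N : ℝ) - 2)
    (hab : 0 ≤ a - b ∧ a - b ≤ ((N : ℝ) - 2) * (p - q)) :
    ¬ ∃ u v : Euc N → ℝ,
        IsHLESol p q a b u v ∧ (∀ x, 0 < u x) ∧ (∀ x, 0 < v x) ∧
        (∫⁻ x : Euc N, ENNReal.ofReal
            (u x ^ ((N : ℝ) / ((2 * (p + 1) + a + p * b) / (p * q - 1))))) < ⊤ ∧
        ∃ C R₀ : ℝ, 0 < C ∧ 0 < R₀ ∧ ∀ x : Euc N, R₀ ≤ ‖x‖ →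
          u x ≤ C * ‖x‖ ^ (-((2 * (p + 1) + a + p * b) / (p * q - 1))) := by
  rintro ⟨u, v, hsol, hu, hv, hint, C₀, R₀, hC₀, hR₀, hdec⟩
  have hN3 : (3 : ℝ) ≤ N := by exact_mod_cast hN
  have hp : 1 ≤ p := by nlinarith
  have hp0 : 0 < p := by linarith
  have hpq' : 0 < p * q - 1 := by linarith
  have huc : Continuous u := hsol.2.2.1
  have hvc : Continuous v := hsol.2.2.2.1
  set α := (2 * (p + 1) + a + p * b) / (p * q - 1) with hαdef
  set β := (2 * (q + 1) + b + q * a) / (p * q - 1) with hβdef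
  set k := ((N : ℝ) + a) / (p + 1) with hkdef
  set m := ((N : ℝ) + b) / (q + 1) with hmdef
  have hα : 0 < α := div_pos (by nlinarith) hpq'
  have hβ : 0 < β := div_pos (by nlinarith) hpq'
  have eα : (p * q - 1) * α = 2 * (p + 1) + a + p * b := mul_div_cancel₀ _ hpq'.ne'
  have eβ : (p * q - 1) * β = 2 * (q + 1) + b + q * a := mul_div_cancel₀ _ hpq'.ne'
  have hβα : p * β = α + 2 + a :=
    mul_left_cancel₀ hpq'.ne' (by linear_combination p * eβ - eα)
  have hαβ : q * α = β + 2 + b :=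
    mul_left_cancel₀ hpq'.ne' (by linear_combination q * eα - eβ)
  have hk : (p + 1) * k = N + a := by
    rw [hkdef]
    field_simp
  have hm : (q + 1) * m = N + b := by
    rw [hmdef]
    field_simp
  have hk0 : 0 < k := div_pos (by linarith) (by linarith)
  have hm0 : 0 < m := div_pos (by linarith) (by linarith)
  have hαm : α < m := by
    have h1 : (p * q - 1) * (m - α) = (1 + p) * (N - 2 - k - m) := by
      linear_combination p * hm + hk - p * hαβ - hβα
    have h2 : 0 < (p * q - 1) * (m - α) := h1 ▸ mul_pos (by linarith) (by linarith)
    linarith [(pos_iff_pos_of_mul_pos h2).1 hpq']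
  have hβk : β < k := by
    have h1 : (p * q - 1) * (k - β) = (1 + q) * (N - 2 - k - m) := by
      linear_combination q * hk + hm - q * hβα - hαβ
    have h2 : 0 < (p * q - 1) * (k - β) := h1 ▸ mul_pos (by linarith) (by linarith)
    linarith [(pos_iff_pos_of_mul_pos h2).1 hpq']
  obtain ⟨B, hB⟩ : ∃ B : ℝ, ∀ x, u x ≤ B := by
    refine exists_bound_of_continuous huc (R := R₀) (C := C₀ * R₀ ^ (-α)) fun x hx => ?_
    exact (hdec x hx).trans (mul_le_mul_of_nonneg_left
      (Real.rpow_le_rpow_of_nonpos hR₀ hx (by linarith)) hC₀.le)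
  have hlim : Filter.Tendsto u (Filter.cocompact (Euc N)) (𝓝 0) := by
    rw [← Metric.cobounded_eq_cocompact]
    have h1 : Filter.Tendsto (fun x : Euc N => C₀ * ‖x‖ ^ (-α)) (Bornology.cobounded _)
        (𝓝 (C₀ * 0)) :=
      ((tendsto_rpow_neg_atTop hα).comp tendsto_norm_cobounded_atTop).const_mul _
    rw [mul_zero] at h1
    refine tendsto_of_tendsto_of_tendsto_of_le_of_le' tendsto_const_nhds h1
      (Filter.Eventually.of_forall fun x => (hu x).le) ?_
    exact (tendsto_norm_cobounded_atTop.eventually_ge_atTop R₀).mono hdec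
  obtain ⟨κ, hκ, hru, hrv⟩ := hsol.exists_newton hN hq hp ha hb hu hv hB hlim
  have hf0 : ∀ y : Euc N, 0 ≤ ‖y‖ ^ a * v y ^ p := fun y => by
    have := hv y
    positivity
  have hg0 : ∀ y : Euc N, 0 ≤ ‖y‖ ^ b * u y ^ q := fun y => by
    have := hu y
    positivity
  obtain ⟨D, hD, hDu⟩ := exists_rpow_bound_of_decay hB hu hC₀.le hdec hα.le le_rfl
  have hgD := weight_le_of_decay (a := b) (τ := β + 2) hu hq.le hD.le hDu (by linarith)
  obtain ⟨D₁, hD₁, hDv⟩ := exists_decay_of_newton hN hκ hv hrv hβ (by linarith) (by positivity) hgD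
  have hfD := weight_le_of_decay (a := a) (τ := α + 2) hv hp0.le hD₁.le hDv (by linarith)
  have hsmall : ∀ ε : ℝ, 0 < ε → ∃ R : ℝ, 0 < R ∧ ∀ x, R ≤ ‖x‖ → u x ≤ ε * ‖x‖ ^ (-α) :=
    fun ε hε => exists_le_of_lintegral_lt_top hN hα hκ (by positivity) hu huc hru hf0 hfD hint hε
  obtain ⟨D₂, hD₂, hDu₂⟩ := exists_fast_decay hN (k := (m + 2 + a) / p) hp hq hpq hb hκ hu hv hru
    hrv hα hβ hβα hαβ hαm (by linarith) (by field_simp) (by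
      rw [div_lt_iff₀ hp0]
      nlinarith) hB hD.le hDu hsmall
  have hgm := weight_le_of_decay (a := b) (τ := (N : ℝ) - m) hu hq.le hD₂ hDu₂ (by linarith)
  obtain ⟨D₃, hD₃, hDv₃⟩ := exists_decay_of_newton hN (c := D₂ ^ q) (τ := (N : ℝ) - 2 - m) hκ hv hrv
    (by linarith) (by linarith) (by positivity) (fun y hy => by
      rw [show (N : ℝ) - 2 - m + 2 = N - m by ring]
      exact hgm y hy)
  obtain ⟨B', hB'⟩ : ∃ B : ℝ, ∀ x, v x ≤ B := by
    refine exists_bound_of_continuous hvc (R := 1) (C := D₃) fun x hx => ?_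
    refine (hDv₃ x (norm_pos_iff.1 (by linarith))).trans (mul_le_of_le_one_right hD₃.le ?_)
    exact Real.rpow_le_one_of_one_le_of_nonpos hx (by linarith)
  obtain ⟨D₄, hD₄, hDv₄⟩ := exists_rpow_bound_of_decay (R := 1) (σ := k) hB' hv hD₃.le
    (fun x hx => hDv₃ x (norm_pos_iff.1 (by linarith))) hk0.le (by linarith)
  have hfk := weight_le_of_decay (a := a) (τ := (N : ℝ) - k) hv hp0.le hD₄.le hDv₄ (by linarith)
  have hf2 := weight_le_of_bound (p := p) hv hp0.le ha hB'
  have hg2 := weight_le_of_bound (p := q) hu hq.le hb hB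
  have hfm : Measurable fun y : Euc N => ‖y‖ ^ a * v y ^ p := measurable_weight hvc
  have hgmeas : Measurable fun y : Euc N => ‖y‖ ^ b * u y ^ q := measurable_weight huc
  have hQ : energyRemainder (fun y : Euc N => ‖y‖ ^ a * v y ^ p)
      (fun y => ‖y‖ ^ b * u y ^ q) < ⊤ := by
    refine energyRemainder_lt_top hN (A := N - k) (A' := N - m)
      (Cf := max (D₄ ^ p) (B' ^ p)) (Cg := max (D₂ ^ q) (B ^ q)) hfm hgmeas
      (le_max_of_le_left (by positivity)) (le_max_of_le_left (by positivity)) hf0 hg0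
      (fun y hy => (hfk y hy).trans ?_) (fun y hy => (hgm y hy).trans ?_)
      (fun y hy hy1 => (hf2 y hy hy1).trans ?_) (fun y hy hy1 => (hg2 y hy hy1).trans ?_)
      (by linarith) (by linarith) (by linarith) (by linarith) (by linarith)
    · exact mul_le_mul_of_nonneg_right (le_max_left _ _) (by positivity)
    · exact mul_le_mul_of_nonneg_right (le_max_left _ _) (by positivity)
    · exact mul_le_mul_of_nonneg_right (le_max_right _ _) (by positivity)
    · exact mul_le_mul_of_nonneg_right (le_max_right _ _) (by positivity)
  refine false_of_mutualEnergy_le hN (c₁ := ((N : ℝ) - 2) / 2 - m) (c₂ := ((N : ℝ) - 2) / 2 - k)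
    hfm hgmeas hf0 hg0 hQ ?_ (by linarith) (mutualEnergy_le hκ hq hu huc hru) fun t => ?_
  · refine mutualEnergy_zero_ne_zero hN hκ hu huc hg0 hgmeas (fun x hx => ?_) hru
    have hux := hu x
    have hx0 : 0 < ‖x‖ := norm_pos_iff.2 hx
    positivity
  · rw [mutualEnergy_swap hfm hgmeas, mutualEnergy_swap hfm hgmeas, neg_zero, ← mul_neg]
    exact mutualEnergy_le hκ hp0 hv hvc hrv (-t)
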